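/- arXiv:2605.15884 — 3 statements merged into one kernel-verified Lean document; each statement's English description precedes it below -/
import Mathlib

section
/- Let R be the unicyclic generator on n ≥ 3 states with rates k⁺ᵢ > 0, k⁻ᵢ ≥ 0, cycle affinity F ≥ 0 and maximum escape rate r. Let λ be a nonreal eigenvalue of R with left eigenvector u. Then −2r < Re λ < 0, every component uᵢ is nonzero, the winding number w = ω(u) satisfies 1 ≤ w ≤ ⌈n/2⌉ − 1, and |Im λ|/(−Re λ) ≤ T · cot(πw/n). -/
open Matrix Finset

/-- Wrapped frequency `|k|ₙ := min (k mod n) ((n - k) mod n)`. -/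
def wrapIdx (n : ℕ) (k : ℤ) : ℤ :=
  min (k % (n : ℤ)) (((n : ℤ) - k) % (n : ℤ))

/-- Winding number `ω(u)` of a vector `u` around the unicycle:
`|(1/2π) ∑ᵢ Arg (u_{i+1}/uᵢ)|ₙ` (the sum divided by `2π` is an integer
whenever `u` is an eigenvector with all components nonzero). -/
noncomputable def windingNum (n : ℕ) [NeZero n] (u : ZMod n → ℂ) : ℤ :=
  wrapIdx n (round ((∑ i : ZMod n, Complex.arg (u (i + 1) / u i)) / (2 * Real.pi)))

/-- The unicyclic generator on `n` states with forward rates `kp` and backward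
rates `km`, viewed as a complex matrix: `R j i = kpᵢ` if `j = i+1`, `kmᵢ` if
`j = i-1`, `-(kpᵢ+kmᵢ)` if `j = i`, and `0` otherwise. -/
noncomputable def uniGenC (n : ℕ) [NeZero n] (kp km : ZMod n → ℝ) :
    Matrix (ZMod n) (ZMod n) ℂ :=
  Matrix.of fun j i =>
    if j = i + 1 then (kp i : ℂ)
    else if j = i - 1 then (km i : ℂ)
    else if j = i then -((kp i : ℂ) + (km i : ℂ))
    else 0

/-- `T = tanh (F / 2n)` where `F = ∑ᵢ ln (kpᵢ/kmᵢ)` is the cycle affinity;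
`T = 1` when the affinity is infinite (some `kmᵢ = 0`). -/
noncomputable def uniT (n : ℕ) [NeZero n] (kp km : ZMod n → ℝ) : ℝ :=
  open Classical in
  if ∀ i, km i ≠ 0 then
    Real.tanh ((∑ i : ZMod n, Real.log (kp i / km i)) / (2 * n))
  else 1

open Real in
/-- The argument of a point of the upper half plane, split by the foot of the altitude from `0`
in the triangle `0, 1, z`. -/
lemma arg_eq_arctan_add_arctan {z : ℂ} (hz : 0 < z.im) :
    z.arg = arctan ((1 - z.re) / z.im) + arctan ((Complex.normSq z - z.re) / z.im) := by
  set y := (1 - z.re) / z.im with hy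
  set w := (Complex.normSq z - z.re) / z.im with hw
  have harg (a : ℝ) : Complex.arg (1 + a * Complex.I) = arctan a := by
    rw [Complex.arg_of_re_nonneg (by simp), arctan_eq_arcsin, Complex.norm_def,
      Complex.normSq_apply]
    simp [pow_two]
  have hne (a : ℝ) : (1 + a * Complex.I : ℂ) ≠ 0 := fun h => by
    simpa using congrArg Complex.re h
  have hpos : 0 < ((1 - z.re) ^ 2 + z.im ^ 2) / z.im ^ 2 := by positivity
  have hmul : (1 + y * Complex.I) * (1 + w * Complex.I) =
      ((((1 - z.re) ^ 2 + z.im ^ 2) / z.im ^ 2 : ℝ) : ℂ) * z := by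
    apply Complex.ext
    · rw [Complex.re_ofReal_mul]
      simp [hy, hw, Complex.normSq_apply]
      field_simp
      ring
    · rw [Complex.im_ofReal_mul]
      simp [hy, hw, Complex.normSq_apply]
      field_simp
      ring
  have := Complex.arg_mul (hne y) (hne w) (by
    rw [harg, harg]
    constructor <;>
      linarith [arctan_lt_pi_div_two y, arctan_lt_pi_div_two w,
        neg_pi_div_two_lt_arctan y, neg_pi_div_two_lt_arctan w])
  rw [harg, harg, hmul, Complex.arg_real_mul _ hpos] at this
  exact this

/-- Tangent line inequality for the cosine on `[-π/2, π/2]`. -/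
lemma cos_le_tangent {a b : ℝ} (ha : a ∈ Set.Icc (-(Real.pi / 2)) (Real.pi / 2))
    (hb : b ∈ Set.Ioo (-(Real.pi / 2)) (Real.pi / 2)) :
    Real.cos a ≤ Real.cos b - Real.sin b * (a - b) := by
  have hc := strictConcaveOn_cos_Icc.concaveOn
  have hb' := Set.Ioo_subset_Icc_self hb
  rcases lt_trichotomy a b with h | h | h
  · have := hc.le_slope_of_hasDerivAt ha hb' h (Real.hasDerivAt_cos b)
    rw [slope_def_field, le_div_iff₀ (by linarith)] at this
    linarith
  · simp [h]
  · have := hc.slope_le_of_hasDerivAt hb' ha h (Real.hasDerivAt_cos b)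
    rw [slope_def_field, div_le_iff₀ (by linarith)] at this
    linarith

open Real in
lemma arctan_add_arctan_le {x t y w : ℝ} (ht : 0 < t) (ht1 : t ≤ 1)
    (h : 2 * (t * x) = (1 + t) * y + (1 - t) * w) :
    x * (arctan y + arctan w) ≤
      2 * x * arctan (x * t) + (log (1 + w ^ 2) - log (1 + y ^ 2)) / 2 := by
  have hy : 0 < cos (arctan y) := cos_arctan_pos y
  have hw : 0 < cos (arctan w) := cos_arctan_pos w
  have hv : 0 < cos (arctan (x * t)) := cos_arctan_pos _
  have sinE (a : ℝ) : sin (arctan a) = a * cos (arctan a) := by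
    rw [sin_arctan, cos_arctan]; ring
  have hsq (a : ℝ) : cos (arctan a) ^ 2 * (1 + a ^ 2) = 1 := by
    rw [cos_sq_arctan]; field_simp
  have hlog (a : ℝ) : log (1 + a ^ 2) = -(2 * log (cos (arctan a))) := by
    have : 1 + a ^ 2 = (cos (arctan a) ^ 2)⁻¹ := by rw [cos_sq_arctan, one_div, inv_inv]
    rw [this, log_inv, log_pow]; push_cast; ring
  set E := log (cos (arctan y) / cos (arctan w)) with hE
  have hEeq : (log (1 + w ^ 2) - log (1 + y ^ 2)) / 2 = E := by
    rw [hlog, hlog, hE, log_div hy.ne' hw.ne']; ring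
  have hexp : exp E = cos (arctan y) / cos (arctan w) := exp_log (by positivity)
  have hexp' : exp (-E) = cos (arctan w) / cos (arctan y) := by rw [exp_neg, hexp, inv_div]
  set τ := arctan y + arctan w - arctan (x * t) with hτ
  have hcos : (1 - t) / 2 * exp E + (1 + t) / 2 * exp (-E) =
      cos τ / cos (arctan (x * t)) := by
    rw [hexp, hexp', hτ, cos_sub, cos_add, sin_add, sinE y, sinE w, sinE (x * t)]
    have h1 := hsq y
    have h2 := hsq w
    field_simp
    generalize cos (arctan y) = p at *
    generalize cos (arctan w) = q at *
    linear_combination (-(1 + t) * q ^ 2) * h1 + (-(1 - t) * p ^ 2) * h2 -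
      p ^ 2 * q ^ 2 * (y + w) * h
  have hlow : 1 - t * E ≤ cos τ / cos (arctan (x * t)) := by
    rw [← hcos]
    nlinarith [add_one_le_exp E, add_one_le_exp (-E)]
  have hτpos : 0 < cos τ := by
    have : 0 < cos τ / cos (arctan (x * t)) := by
      rw [← hcos]
      have := exp_pos E
      have := exp_pos (-E)
      have : 0 ≤ (1 - t) / 2 * exp E := mul_nonneg (by linarith) (by positivity)
      positivity
    exact (div_pos_iff_of_pos_right hv).1 this
  have hy1 := arctan_lt_pi_div_two y
  have hw1 := arctan_lt_pi_div_two w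
  have hv1 := arctan_lt_pi_div_two (x * t)
  have hy2 := neg_pi_div_two_lt_arctan y
  have hw2 := neg_pi_div_two_lt_arctan w
  have hv2 := neg_pi_div_two_lt_arctan (x * t)
  have hτmem : τ ∈ Set.Icc (-(π / 2)) (π / 2) := by
    constructor
    · by_contra! hlt
      have := cos_nonpos_of_pi_div_two_le_of_le (x := -τ) (by linarith) (by linarith)
      rw [cos_neg] at this
      linarith
    · by_contra! hlt
      have := cos_nonpos_of_pi_div_two_le_of_le (x := τ) (by linarith) (by linarith)
      linarith
  have hup := cos_le_tangent hτmem ⟨hv2, hv1⟩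
  rw [sinE] at hup
  rw [le_div_iff₀ hv] at hlow
  have h3 : (1 - t * E) * cos (arctan (x * t)) ≤
      (1 - x * t * (τ - arctan (x * t))) * cos (arctan (x * t)) := by linarith
  have h4 := le_of_mul_le_mul_right h3 hv
  have h5 : x * (τ - arctan (x * t)) ≤ E := by
    refine le_of_mul_le_mul_left (a := t) ?_ ht
    linarith
  rw [hEeq]
  linarith

lemma concaveOn_arctan_mul_tanh {x : ℝ} (hx : 0 ≤ x) :
    ConcaveOn ℝ (Set.Ici 0) fun h => Real.arctan (x * Real.tanh h) := by
  have hd (h : ℝ) : HasDerivAt (fun h => Real.arctan (x * Real.tanh h))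
      (x / (Real.cosh h ^ 2 + x ^ 2 * Real.sinh h ^ 2)) h := by
    have hc := Real.cosh_pos h
    have h1 : HasDerivAt Real.tanh
        ((Real.cosh h * Real.cosh h - Real.sinh h * Real.sinh h) / Real.cosh h ^ 2) h := by
      have := (Real.hasDerivAt_sinh h).div (Real.hasDerivAt_cosh h) hc.ne'
      refine this.congr_of_eventuallyEq (Filter.Eventually.of_forall fun y => ?_)
      simp [Real.tanh_eq_sinh_div_cosh]
    have h2 := (h1.const_mul x).arctan
    convert h2 using 1
    have h3 : Real.cosh h * Real.cosh h - Real.sinh h * Real.sinh h = 1 := by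
      linarith [Real.cosh_sq h]
    rw [h3, Real.tanh_eq_sinh_div_cosh]
    field_simp
  have hdiff : Differentiable ℝ fun h => Real.arctan (x * Real.tanh h) :=
    fun h => (hd h).differentiableAt
  refine AntitoneOn.concaveOn_of_deriv (convex_Ici 0) hdiff.continuous.continuousOn
    hdiff.differentiableOn ?_
  intro p hp q hq hpq
  rw [interior_Ici, Set.mem_Ioi] at hp hq
  rw [(hd p).deriv, (hd q).deriv]
  have hcp := Real.cosh_pos p
  have hs : Real.sinh p ≤ Real.sinh q := Real.sinh_le_sinh.2 hpq
  have hs0 : 0 ≤ Real.sinh p := Real.sinh_nonneg_iff.2 hp.le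
  have hc : Real.cosh p ≤ Real.cosh q := Real.cosh_le_cosh.2 (by
    rw [abs_of_pos hp, abs_of_pos hq]; exact hpq)
  gcongr

lemma tanh_half_log_div {a b : ℝ} (ha : 0 < a) (hb : 0 < b) :
    Real.tanh (Real.log (a / b) / 2) = (a - b) / (a + b) := by
  have h2 : Real.exp (Real.log (a / b) / 2) ^ 2 = a / b := by
    rw [← Real.exp_nat_mul]
    push_cast
    rw [mul_div_cancel₀ _ two_ne_zero, Real.exp_log (div_pos ha hb)]
  rw [Real.tanh_eq, Real.exp_neg]
  have := Real.exp_pos (Real.log (a / b) / 2)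
  set e := Real.exp (Real.log (a / b) / 2)
  have h3 : (e - e⁻¹) / (e + e⁻¹) = (e ^ 2 - 1) / (e ^ 2 + 1) := by field_simp
  rw [h3, h2]
  field_simp

lemma ZMod.induction_add_one {n : ℕ} [NeZero n] {P : ZMod n → Prop} {j : ZMod n} (hj : P j)
    (hstep : ∀ i, P i → P (i + 1)) (i : ZMod n) : P i := by
  have h (m : ℕ) : P (j + m) := by
    induction m with
    | zero => simpa using hj
    | succ m ih => simpa [add_assoc] using hstep _ ih
  simpa using h (i - j).val

lemma ZMod.sum_comp_sub_one {n : ℕ} [NeZero n] {M : Type*} [AddCommMonoid M] (f : ZMod n → M) :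
    ∑ i, f (i - 1) = ∑ i, f i :=
  Equiv.sum_comp (Equiv.subRight 1) f

lemma ZMod.sum_comp_add_one {n : ℕ} [NeZero n] {M : Type*} [AddCommMonoid M] (f : ZMod n → M) :
    ∑ i, f (i + 1) = ∑ i, f i :=
  Equiv.sum_comp (Equiv.addRight 1) f

lemma uniGenC_transpose_mulVec {n : ℕ} [NeZero n] (hn : 3 ≤ n) (kp km : ZMod n → ℝ)
    (u : ZMod n → ℂ) (i : ZMod n) :
    ((uniGenC n kp km)ᵀ *ᵥ u) i =
      kp i * (u (i + 1) - u i) + km i * (u (i - 1) - u i) := by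
  have hcast (m : ℕ) (h0 : 0 < m) (hm : m < 3) : (m : ZMod n) ≠ 0 := by
    rw [Ne, ZMod.natCast_eq_zero_iff]
    exact fun h => by have := Nat.le_of_dvd h0 h; omega
  have h1 : (1 : ZMod n) ≠ 0 := by simpa using hcast 1 (by norm_num) (by norm_num)
  have h2 : (2 : ZMod n) ≠ 0 := by simpa using hcast 2 (by norm_num) (by norm_num)
  have e1 : i - 1 ≠ i + 1 := fun h => h2 (by linear_combination -h)
  have e2 : i ≠ i + 1 := fun h => h1 (by linear_combination -h)
  have e3 : i ≠ i - 1 := fun h => h1 (by linear_combination h)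
  have hterm (j : ZMod n) : uniGenC n kp km j i * u j =
      (if j = i + 1 then (kp i : ℂ) * u j else 0) + (if j = i - 1 then (km i : ℂ) * u j else 0) +
        (if j = i then -((kp i : ℂ) + km i) * u j else 0) := by
    simp only [uniGenC, Matrix.of_apply]
    by_cases c1 : j = i + 1
    · subst c1; simp [e1.symm, e2.symm]
    · by_cases c2 : j = i - 1
      · subst c2; simp [e1, e3.symm]
      · by_cases c3 : j = i
        · subst c3; simp [e2, e3]
        · simp [c1, c2, c3]
  simp only [Matrix.mulVec, dotProduct, Matrix.transpose_apply, hterm, Finset.sum_add_distrib,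
    Finset.sum_ite_eq', Finset.mem_univ, if_true]
  ring

/-- Gershgorin bound for the real part of a nonreal eigenvalue. -/
lemma unicyclic_re_mem {n : ℕ} [NeZero n] {kp km : ZMod n → ℝ} (hkp : ∀ i, 0 < kp i)
    (hkm : ∀ i, 0 ≤ km i) {lam : ℂ} (hlam : lam.im ≠ 0) {u : ZMod n → ℂ} (hu : u ≠ 0)
    (h : ∀ i, lam * u i = kp i * (u (i + 1) - u i) + km i * (u (i - 1) - u i)) :
    ∃ i, -(2 * (kp i + km i)) < lam.re ∧ lam.re < 0 := by
  obtain ⟨i, hi⟩ := Finite.exists_max fun i => ‖u i‖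
  have hpos : 0 < ‖u i‖ := by
    obtain ⟨j, hj⟩ := Function.ne_iff.1 hu
    exact (norm_pos_iff.2 hj).trans_le (hi j)
  have hk : 0 < kp i + km i := add_pos_of_pos_of_nonneg (hkp i) (hkm i)
  have heq : (lam + ((kp i + km i : ℝ) : ℂ)) * u i = kp i * u (i + 1) + km i * u (i - 1) := by
    push_cast
    linear_combination h i
  have hle : ‖lam + ((kp i + km i : ℝ) : ℂ)‖ * ‖u i‖ ≤ (kp i + km i) * ‖u i‖ := by
    rw [← norm_mul, heq]
    refine (norm_add_le _ _).trans ?_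
    rw [norm_mul, norm_mul, Complex.norm_of_nonneg (hkp i).le, Complex.norm_of_nonneg (hkm i),
      add_mul]
    exact add_le_add (mul_le_mul_of_nonneg_left (hi _) (hkp i).le)
      (mul_le_mul_of_nonneg_left (hi _) (hkm i))
  have hle := le_of_mul_le_mul_right hle hpos
  have hsq := pow_le_pow_left₀ (norm_nonneg _) hle 2
  rw [← Complex.normSq_eq_norm_sq, Complex.normSq_apply] at hsq
  simp only [Complex.add_re, Complex.add_im, Complex.ofReal_re, Complex.ofReal_im, add_zero] at hsq
  have him : 0 < lam.im * lam.im := mul_self_pos.2 hlam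
  refine ⟨i, ?_, ?_⟩ <;> nlinarith [sq_nonneg lam.re]

/-- An eigenvector for an eigenvalue in the upper half plane turns counterclockwise at every
step around the cycle. -/
lemma unicyclic_im_div_pos {n : ℕ} [NeZero n] {kp km : ZMod n → ℝ} (hkp : ∀ i, 0 < kp i)
    (hkm : ∀ i, 0 ≤ km i)
    (hF : (∀ i, km i ≠ 0) → 0 ≤ ∑ i : ZMod n, Real.log (kp i / km i))
    {lam : ℂ} (hlam : 0 < lam.im) {u : ZMod n → ℂ} (hu : u ≠ 0)
    (h : ∀ i, lam * u i = kp i * (u (i + 1) - u i) + km i * (u (i - 1) - u i)) :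
    (∀ i, u i ≠ 0) ∧ ∀ i, 0 < (u (i + 1) / u i).im := by
  set J : ZMod n → ℝ := fun i => (starRingEnd ℂ (u i) * u (i + 1)).im with hJ
  have hrec (i : ZMod n) :
      kp i * J i = lam.im * Complex.normSq (u i) + km i * J (i - 1) := by
    have h1 := congrArg (fun z => (starRingEnd ℂ (u i) * z).im) (h i)
    simp [hJ, Complex.normSq_apply] at h1 ⊢
    linear_combination -h1
  have hns (i : ZMod n) : 0 ≤ lam.im * Complex.normSq (u i) :=
    mul_nonneg hlam.le (Complex.normSq_nonneg _)
  have hex : ∃ j, 0 ≤ J j := by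
    by_contra! hneg
    have hupos (i : ZMod n) : 0 < Complex.normSq (u i) := by
      rw [Complex.normSq_pos]
      intro h0
      simpa [hJ, h0] using hneg i
    have hlt (i : ZMod n) : kp i * -J i < km i * -J (i - 1) := by
      have := hrec i
      have := mul_pos hlam (hupos i)
      linarith
    have hkm' (i : ZMod n) : 0 < km i := by
      refine (hkm i).lt_of_ne fun h0 => ?_
      have h1 := hlt i
      rw [← h0, zero_mul] at h1
      exact absurd h1 (not_lt.2 (mul_nonneg (hkp i).le (neg_pos.2 (hneg i)).le))
    have hlog (i : ZMod n) :
        Real.log (kp i / km i) < Real.log (-J (i - 1)) - Real.log (-J i) := by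
      have p1 := neg_pos.2 (hneg i)
      have p2 := neg_pos.2 (hneg (i - 1))
      rw [← Real.log_div p2.ne' p1.ne']
      refine Real.log_lt_log (div_pos (hkp i) (hkm' i)) ?_
      rw [div_lt_div_iff₀ (hkm' i) p1]
      linarith [hlt i]
    have hsum := Finset.sum_lt_sum_of_nonempty (s := Finset.univ) Finset.univ_nonempty
      fun i _ => hlog i
    rw [Finset.sum_sub_distrib, ZMod.sum_comp_sub_one fun i => Real.log (-J i), sub_self] at hsum
    exact absurd (hF fun i => (hkm' i).ne') (not_le.2 hsum)
  obtain ⟨j, hj⟩ := hex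
  have hJ0 : ∀ i, 0 ≤ J i := by
    refine ZMod.induction_add_one hj fun i hi => ?_
    have h1 := hrec (i + 1)
    rw [add_sub_cancel_right] at h1
    have h2 := mul_nonneg (hkm (i + 1)) hi
    exact nonneg_of_mul_nonneg_right (by linarith [hns (i + 1)]) (hkp (i + 1))
  have hu0 : ∀ i, u i ≠ 0 := by
    obtain ⟨j, hj⟩ := Function.ne_iff.1 hu
    refine ZMod.induction_add_one (P := fun i => u i ≠ 0) hj fun i hi h0 => ?_
    have h1 := hrec i
    have h2 : J i = 0 := by simp [hJ, h0]
    have h3 := mul_pos hlam (Complex.normSq_pos.2 hi)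
    have h4 := mul_nonneg (hkm i) (hJ0 (i - 1))
    rw [h2, mul_zero] at h1
    linarith
  refine ⟨hu0, fun i => ?_⟩
  have hpos : 0 < J i := by
    have h3 := mul_pos hlam (Complex.normSq_pos.2 (hu0 i))
    have h4 := mul_nonneg (hkm i) (hJ0 (i - 1))
    exact pos_of_mul_pos_right (by rw [hrec i]; linarith) (hkp i).le
  have : u (i + 1) / u i =
      (((Complex.normSq (u i))⁻¹ : ℝ) : ℂ) * (starRingEnd ℂ (u i) * u (i + 1)) := by
    rw [div_eq_mul_inv, Complex.inv_def]
    push_cast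
    ring
  rw [this, Complex.im_ofReal_mul]
  exact mul_pos (inv_pos.2 (Complex.normSq_pos.2 (hu0 i))) hpos

/-- The arguments of the successive ratios around a closed cycle add up to a multiple of `2π`. -/
lemma exists_sum_arg_div_eq {n : ℕ} [NeZero n] {u : ZMod n → ℂ} (hu : ∀ i, u i ≠ 0) :
    ∃ m : ℤ, ∑ i, (u (i + 1) / u i).arg = m * (2 * Real.pi) := by
  have hexp (i : ZMod n) : Complex.exp ((u (i + 1) / u i).arg * Complex.I) =
      (u (i + 1) / ‖u (i + 1)‖) / (u i / ‖u i‖) := by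
    have h1 := Complex.norm_mul_exp_arg_mul_I (u (i + 1) / u i)
    have h2 : (‖u i‖ : ℂ) ≠ 0 := by simp [hu]
    have h3 : (‖u (i + 1)‖ : ℂ) ≠ 0 := by simp [hu]
    have h4 := hu i
    rw [norm_div] at h1
    push_cast at h1
    field_simp at h1 ⊢
    linear_combination h1
  have hprod : Complex.exp ((∑ i, (u (i + 1) / u i).arg : ℝ) * Complex.I) = 1 := by
    push_cast
    rw [Finset.sum_mul, Complex.exp_sum, Finset.prod_congr rfl fun i _ => hexp i,
      Finset.prod_div_distrib,
      show ∏ i, u (i + 1) / (‖u (i + 1)‖ : ℂ) = ∏ i, u i / (‖u i‖ : ℂ) from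
        Equiv.prod_comp (Equiv.addRight (1 : ZMod n)) fun i => u i / (‖u i‖ : ℂ)]
    exact div_self (Finset.prod_ne_zero_iff.2 fun i _ => div_ne_zero (hu i) (by simp [hu]))
  obtain ⟨m, hm⟩ := Complex.exp_eq_one_iff.1 hprod
  refine ⟨m, ?_⟩
  have := congrArg Complex.im hm
  simpa using this

open Real in
/-- The total turning angle is at most `2 ∑ arctan (x tᵢ)`, where `x = -Re λ / Im λ` and `tᵢ`
is the relative current out of state `i`. -/
lemma unicyclic_sum_arg_le {n : ℕ} [NeZero n] {kp km : ZMod n → ℝ} (hkp : ∀ i, 0 < kp i)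
    (hkm : ∀ i, 0 ≤ km i) {lam : ℂ} (hlam : 0 < lam.im) (hre : lam.re < 0) {u : ZMod n → ℂ}
    (h : ∀ i, lam * u i = kp i * (u (i + 1) - u i) + km i * (u (i - 1) - u i))
    (hu : ∀ i, u i ≠ 0) (him : ∀ i, 0 < (u (i + 1) / u i).im) :
    ∃ t : ZMod n → ℝ, (∀ i, 0 < t i ∧ t i ≤ 1) ∧
      ∑ i, (u (i + 1) / u i).arg ≤ 2 * ∑ i, arctan (-lam.re / lam.im * t i) ∧
      ((∀ i, km i ≠ 0) → ∃ f : ZMod n → ℝ, (∀ i, 0 ≤ f i) ∧ (∀ i, t i = tanh (f i / 2)) ∧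
        ∑ i, f i = ∑ i, log (kp i / km i)) := by
  set z : ZMod n → ℂ := fun i => u (i + 1) / u i with hz
  have hN (i : ZMod n) : 0 < Complex.normSq (z i) :=
    Complex.normSq_pos.2 (div_ne_zero (hu _) (hu _))
  have hNu (i : ZMod n) : Complex.normSq (z i) =
      Complex.normSq (u (i + 1)) / Complex.normSq (u i) := Complex.normSq_div _ _
  set α : ZMod n → ℝ := fun i => kp i * (z i).im with hα
  set β : ZMod n → ℝ := fun i => km i * ((z (i - 1)).im / Complex.normSq (z (i - 1))) with hβ
  set y : ZMod n → ℝ := fun i => (1 - (z i).re) / (z i).im with hy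
  set w : ZMod n → ℝ := fun i => (Complex.normSq (z i) - (z i).re) / (z i).im with hw
  have hα0 (i : ZMod n) : 0 < α i := mul_pos (hkp i) (him i)
  have hβ0 (i : ZMod n) : 0 ≤ β i := mul_nonneg (hkm i) (div_pos (him _) (hN _)).le
  have heq (i : ZMod n) : lam = kp i * (z i - 1) + km i * ((z (i - 1))⁻¹ - 1) := by
    have h1 := h i
    have h2 := hu i
    simp only [hz, sub_add_cancel, inv_div]
    field_simp
    linear_combination h1
  have hdiff (i : ZMod n) : α i - β i = lam.im := by
    conv_rhs => rw [heq i]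
    simp [hα, hβ]
    ring
  have hrel (i : ZMod n) : α i * y i + β i * w (i - 1) = -lam.re := by
    conv_rhs => rw [heq i]
    have h1 := (him i).ne'
    have h2 := (him (i - 1)).ne'
    have h3 := (hN (i - 1)).ne'
    simp only [hα, hβ, hy, hw, Complex.add_re, Complex.re_ofReal_mul, Complex.sub_re,
      Complex.one_re, Complex.inv_re]
    change (z i).im ≠ 0 at h1
    change (z (i - 1)).im ≠ 0 at h2
    field_simp
    ring
  have hlogs (i : ZMod n) : log (1 + w i ^ 2) - log (1 + y i ^ 2) =
      log (Complex.normSq (u (i + 1))) - log (Complex.normSq (u i)) := by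
    have h1 : 1 + w i ^ 2 = (1 + y i ^ 2) * Complex.normSq (z i) := by
      have h1 : (z i).im ≠ 0 := (him i).ne'
      simp only [hy, hw, Complex.normSq_apply]
      field_simp
      ring
    rw [h1, log_mul (by positivity) (hN i).ne', hNu,
      log_div (Complex.normSq_pos.2 (hu _)).ne' (Complex.normSq_pos.2 (hu _)).ne']
    ring
  have hsumlog : ∑ i, (log (1 + w (i - 1) ^ 2) - log (1 + y i ^ 2)) = 0 := by
    rw [Finset.sum_sub_distrib, ZMod.sum_comp_sub_one fun i => log (1 + w i ^ 2),
      ← Finset.sum_sub_distrib, Finset.sum_congr rfl fun i _ => hlogs i, Finset.sum_sub_distrib,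
      ZMod.sum_comp_add_one fun i => log (Complex.normSq (u i)), sub_self]
  have hsumarg : ∑ i, (z i).arg = ∑ i, (arctan (y i) + arctan (w (i - 1))) := by
    rw [Finset.sum_add_distrib, ZMod.sum_comp_sub_one fun i => arctan (w i),
      ← Finset.sum_add_distrib]
    exact Finset.sum_congr rfl fun i _ => arg_eq_arctan_add_arctan (him i)
  have hαβ (i : ZMod n) : 0 < α i + β i := add_pos_of_pos_of_nonneg (hα0 i) (hβ0 i)
  have ht (i : ZMod n) : 0 < lam.im / (α i + β i) ∧ lam.im / (α i + β i) ≤ 1 := by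
    refine ⟨div_pos hlam (hαβ i), (div_le_one (hαβ i)).2 ?_⟩
    linarith [hdiff i, hβ0 i]
  have hx : 0 < -lam.re / lam.im := div_pos (neg_pos.2 hre) hlam
  refine ⟨fun i => lam.im / (α i + β i), ht, ?_, fun hkm' => ?_⟩
  · have hsite (i : ZMod n) := arctan_add_arctan_le (x := -lam.re / lam.im) (y := y i)
      (w := w (i - 1)) (ht i).1 (ht i).2 (by
        have h1 := (hαβ i).ne'
        field_simp
        linear_combination (-2) * hrel i + (y i - w (i - 1)) * hdiff i)
    have hsum := Finset.sum_le_sum fun i (_ : i ∈ Finset.univ) => hsite i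
    rw [← Finset.mul_sum, ← hsumarg, Finset.sum_add_distrib, ← Finset.sum_div, hsumlog, zero_div,
      add_zero, ← Finset.mul_sum] at hsum
    refine le_of_mul_le_mul_left (a := -lam.re / lam.im) ?_ hx
    linarith
  · have hβ1 (i : ZMod n) : 0 < β i :=
      mul_pos ((hkm i).lt_of_ne' (hkm' i)) (div_pos (him _) (hN _))
    refine ⟨fun i => log (α i / β i), fun i => log_nonneg ?_, fun i => ?_, ?_⟩
    · rw [one_le_div (hβ1 i)]
      linarith [hdiff i]
    · rw [tanh_half_log_div (hα0 i) (hβ1 i), hdiff]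
    · have hterm (i : ZMod n) : log (α i / β i) = log (kp i / km i) +
          (log (z i).im - log (z (i - 1)).im) + (log (Complex.normSq (u i)) -
            log (Complex.normSq (u (i - 1)))) := by
        have p1 := (hkp i).ne'
        have p2 := hkm' i
        have p3 : (z i).im ≠ 0 := (him i).ne'
        have p4 : (z (i - 1)).im ≠ 0 := (him (i - 1)).ne'
        have p5 := (Complex.normSq_pos.2 (hu i)).ne'
        have p6 := (Complex.normSq_pos.2 (hu (i - 1))).ne'
        rw [log_div (hα0 i).ne' (hβ1 i).ne', log_div p1 p2]
        simp only [hα, hβ]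
        rw [log_mul p1 p3, log_mul p2 (div_ne_zero p4 (hN _).ne'), log_div p4 (hN _).ne', hNu,
          sub_add_cancel, log_div p5 p6]
        ring
      rw [Finset.sum_congr rfl fun i _ => hterm i, Finset.sum_add_distrib,
        Finset.sum_add_distrib, Finset.sum_sub_distrib, Finset.sum_sub_distrib,
        ZMod.sum_comp_sub_one fun i => log (z i).im,
        ZMod.sum_comp_sub_one fun i => log (Complex.normSq (u i))]
      ring

open Real in
lemma unicyclic_sum_arg_le_affinity {n : ℕ} [NeZero n] {kp km : ZMod n → ℝ}
    (hkp : ∀ i, 0 < kp i) (hkm : ∀ i, 0 ≤ km i) {lam : ℂ} (hlam : 0 < lam.im) (hre : lam.re < 0)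
    {u : ZMod n → ℂ}
    (h : ∀ i, lam * u i = kp i * (u (i + 1) - u i) + km i * (u (i - 1) - u i))
    (hu : ∀ i, u i ≠ 0) (him : ∀ i, 0 < (u (i + 1) / u i).im) :
    ∑ i, (u (i + 1) / u i).arg ≤ 2 * n * arctan (-lam.re / lam.im * uniT n kp km) := by
  obtain ⟨t, ht, hle, hfin⟩ := unicyclic_sum_arg_le hkp hkm hlam hre h hu him
  have hx : 0 ≤ -lam.re / lam.im := (div_pos (neg_pos.2 hre) hlam).le
  refine hle.trans ?_
  rw [mul_assoc]
  refine mul_le_mul_of_nonneg_left ?_ zero_le_two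
  have hn : (0 : ℝ) < n := Nat.cast_pos.2 (NeZero.pos n)
  by_cases hk : ∀ i, km i ≠ 0
  · obtain ⟨f, hf0, hft, hfs⟩ := hfin hk
    rw [uniT, if_pos hk, ← hfs]
    have hJ := (concaveOn_arctan_mul_tanh hx).le_map_sum (t := Finset.univ)
      (w := fun _ : ZMod n => (n : ℝ)⁻¹) (p := fun i => f i / 2) (fun _ _ => by positivity)
      (by simp [ZMod.card]) (fun i _ => div_nonneg (hf0 i) zero_le_two)
    simp only [smul_eq_mul, ← Finset.mul_sum, ← Finset.sum_div] at hJ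
    rw [inv_mul_le_iff₀ hn] at hJ
    simp only [hft]
    convert hJ using 5
    field_simp
  · rw [uniT, if_neg hk, mul_one]
    have := Finset.sum_le_card_nsmul Finset.univ (fun i => arctan (-lam.re / lam.im * t i))
      (arctan (-lam.re / lam.im)) fun i _ =>
        arctan_strictMono.monotone (mul_le_of_le_one_right hx (ht i).2)
    simpa [ZMod.card] using this

open Real in
lemma unicyclic_of_im_pos {n : ℕ} [NeZero n] {kp km : ZMod n → ℝ} (hkp : ∀ i, 0 < kp i)
    (hkm : ∀ i, 0 ≤ km i)
    (hF : (∀ i, km i ≠ 0) → 0 ≤ ∑ i : ZMod n, log (kp i / km i))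
    {lam : ℂ} (hlam : 0 < lam.im) {u : ZMod n → ℂ} (hu : u ≠ 0)
    (h : ∀ i, lam * u i = kp i * (u (i + 1) - u i) + km i * (u (i - 1) - u i)) :
    (∀ i, u i ≠ 0) ∧ (∀ i, 0 < (u (i + 1) / u i).im) ∧
      ∃ m : ℤ, ∑ i, (u (i + 1) / u i).arg = m * (2 * π) ∧ 0 < m ∧ 2 * m < n ∧
        lam.im / -lam.re ≤ uniT n kp km * cot (π * m / n) := by
  obtain ⟨hu0, him⟩ := unicyclic_im_div_pos hkp hkm hF hlam hu h
  obtain ⟨_, _, hre⟩ := unicyclic_re_mem hkp hkm hlam.ne' hu h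
  obtain ⟨m, hm⟩ := exists_sum_arg_div_eq hu0
  have hn : (0 : ℝ) < n := Nat.cast_pos.2 (NeZero.pos n)
  have harg (i : ZMod n) : 0 < (u (i + 1) / u i).arg ∧ (u (i + 1) / u i).arg < π := by
    refine ⟨(Complex.arg_nonneg_iff.2 (him i).le).lt_of_ne fun h0 => ?_,
      Complex.arg_lt_pi_iff.2 (Or.inr (him i).ne')⟩
    exact (him i).ne' (Complex.arg_eq_zero_iff.1 h0.symm).2
  have h0 : 0 < ∑ i, (u (i + 1) / u i).arg :=
    Finset.sum_pos (fun i _ => (harg i).1) Finset.univ_nonempty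
  have h1 : ∑ i, (u (i + 1) / u i).arg < n * π := by
    have := Finset.sum_lt_sum_of_nonempty (s := Finset.univ) Finset.univ_nonempty
      fun i (_ : i ∈ Finset.univ) => (harg i).2
    simpa [ZMod.card] using this
  rw [hm] at h0 h1
  have hm0 : (0 : ℝ) < m := pos_of_mul_pos_left h0 (by positivity)
  have hmn : (2 : ℝ) * m < n := lt_of_mul_lt_mul_right (by linarith) pi_pos.le
  refine ⟨hu0, him, m, hm, by exact_mod_cast hm0, by exact_mod_cast hmn, ?_⟩
  have hle := unicyclic_sum_arg_le_affinity hkp hkm hlam hre h hu0 him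
  rw [hm] at hle
  have hφ : π * m / n ≤ arctan (-lam.re / lam.im * uniT n kp km) := by
    rw [div_le_iff₀ hn]
    linarith
  have hφ0 : 0 < π * m / n := by positivity
  have hφ1 : π * m / n < π / 2 := by
    rw [div_lt_div_iff₀ hn two_pos]
    nlinarith [pi_pos]
  have htan : tan (π * m / n) ≤ -lam.re / lam.im * uniT n kp km := by
    rw [← arctan_strictMono.le_iff_le, arctan_tan (by linarith) hφ1]
    exact hφ
  have htan0 : 0 < tan (π * m / n) := tan_pos_of_pos_of_lt_pi_div_two hφ0 hφ1
  rw [cot_eq_cos_div_sin, ← inv_div (sin _), ← tan_eq_sin_div_cos, ← div_eq_mul_inv, le_div_iff₀ htan0,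
    div_mul_eq_mul_div, div_le_iff₀ (neg_pos.2 hre)]
  rw [div_mul_eq_mul_div, le_div_iff₀ hlam] at htan
  linarith

lemma wrapIdx_of_pos {n : ℕ} {m : ℤ} (h0 : 0 < m) (h1 : 2 * m < n) : wrapIdx n m = m := by
  rw [wrapIdx, Int.emod_eq_of_lt h0.le (by linarith),
    Int.emod_eq_of_lt (by linarith) (by linarith), min_eq_left (by linarith)]

lemma wrapIdx_neg (n : ℕ) (m : ℤ) : wrapIdx n (-m) = wrapIdx n m := by
  have h1 : -m % (n : ℤ) = (n - m) % n := by
    rw [sub_eq_add_neg, Int.add_emod_left]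
  have h2 : ((n : ℤ) - -m) % n = m % n := by
    rw [sub_neg_eq_add, Int.add_emod_left]
  rw [wrapIdx, wrapIdx, h1, h2, min_comm]

lemma windingNum_eq_wrapIdx {n : ℕ} [NeZero n] {u : ZMod n → ℂ} {m : ℤ}
    (h : ∑ i, (u (i + 1) / u i).arg = m * (2 * Real.pi)) :
    windingNum n u = wrapIdx n m := by
  rw [windingNum, h, mul_div_cancel_right₀ _ (by positivity), round_intCast]

theorem unicyclic_primal_bound
    (n : ℕ) [NeZero n] (hn : 3 ≤ n)
    (kp km : ZMod n → ℝ) (hkp : ∀ i, 0 < kp i) (hkm : ∀ i, 0 ≤ km i)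
    (hF : (∀ i, km i ≠ 0) → 0 ≤ ∑ i : ZMod n, Real.log (kp i / km i))
    (r : ℝ) (hr : IsGreatest (Set.range fun i : ZMod n => kp i + km i) r)
    (lam : ℂ) (hlam : lam.im ≠ 0)
    (u : ZMod n → ℂ) (hu : u ≠ 0)
    (heig : (uniGenC n kp km)ᵀ *ᵥ u = lam • u) :
    (-(2 * r) < lam.re ∧ lam.re < 0) ∧
    (∀ i, u i ≠ 0) ∧
    (1 ≤ windingNum n u ∧ windingNum n u ≤ ((n : ℤ) + 1) / 2 - 1) ∧
    |lam.im| / (-lam.re) ≤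
      uniT n kp km * Real.cot (Real.pi * (windingNum n u : ℝ) / n) := by
  have h (i : ZMod n) :
      lam * u i = kp i * (u (i + 1) - u i) + km i * (u (i - 1) - u i) := by
    rw [← uniGenC_transpose_mulVec hn, heig, Pi.smul_apply, smul_eq_mul]
  obtain ⟨i, hre, hre0⟩ := unicyclic_re_mem hkp hkm hlam hu h
  refine ⟨⟨by linarith [hr.2 ⟨i, rfl⟩], hre0⟩, ?_⟩
  suffices hsuff : (∀ i, u i ≠ 0) ∧ ∃ m : ℤ, windingNum n u = wrapIdx n m ∧ 0 < m ∧ 2 * m < n ∧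
      |lam.im| / -lam.re ≤ uniT n kp km * Real.cot (Real.pi * m / n) by
    obtain ⟨hu0, m, hw, hm0, hmn, hle⟩ := hsuff
    rw [wrapIdx_of_pos hm0 hmn] at hw
    rw [hw]
    exact ⟨hu0, ⟨by omega, by omega⟩, hle⟩
  rcases hlam.lt_or_gt with hneg | hpos
  · obtain ⟨hu0, him, m, hm, hm0, hmn, hle⟩ := unicyclic_of_im_pos hkp hkm hF
      (lam := starRingEnd ℂ lam) (u := fun i => starRingEnd ℂ (u i)) (by simpa using hneg)
      (fun h0 => hu (funext fun i => by simpa using congrFun h0 i))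
      (fun i => by simpa using congrArg (starRingEnd ℂ) (h i))
    refine ⟨fun i => by simpa using hu0 i, m, ?_, hm0, hmn, ?_⟩
    · rw [← wrapIdx_neg]
      refine windingNum_eq_wrapIdx ?_
      rw [Int.cast_neg, neg_mul, ← hm, ← Finset.sum_neg_distrib]
      refine Finset.sum_congr rfl fun i _ => ?_
      have him' := him i
      rw [← map_div₀, Complex.conj_im] at him'
      rw [← map_div₀, Complex.arg_conj, if_neg, neg_neg]
      exact (Complex.arg_lt_pi_iff.2 (Or.inr (by linarith))).ne
    · simpa [abs_of_neg hneg] using hle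
  · obtain ⟨hu0, -, m, hm, hm0, hmn, hle⟩ := unicyclic_of_im_pos hkp hkm hF hpos hu h
    exact ⟨hu0, m, windingNum_eq_wrapIdx hm, hm0, hmn, by rwa [abs_of_pos hpos]⟩
end

section
/- Let R be the unicyclic generator on n ≥ 3 states with rates k⁺ᵢ > 0, k⁻ᵢ ≥ 0, cycle affinity F ≥ 0 and maximum escape rate r. Let λ be a nonreal eigenvalue of R with left eigenvector u. Then −2r < Re λ < 0, every component uᵢ is nonzero, the winding number w = ω(u) satisfies 1 ≤ w ≤ ⌈n/2⌉ − 1, and |Im λ|/(2r + Re λ) ≤ T · tan(πw/n). -/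
open Matrix Finset

namespace Unicyclic

/-- A property that propagates along `i ↦ i + 1` holds on the whole cycle once it holds somewhere. -/
theorem forall_of_add_one {n : ℕ} [NeZero n] {P : ZMod n → Prop}
    (hstep : ∀ i, P i → P (i + 1)) {i₀ : ZMod n} (h₀ : P i₀) (j : ZMod n) : P j := by
  have h : ∀ k : ℕ, P (i₀ + k) := by
    intro k
    induction k with
    | zero => simpa using h₀
    | succ k ih => simpa [add_assoc] using hstep _ ih
  simpa using h (j - i₀).val

/-- A property that propagates along `i ↦ i - 1` holds on the whole cycle once it holds somewhere. -/
theorem forall_of_sub_one {n : ℕ} [NeZero n] {P : ZMod n → Prop}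
    (hstep : ∀ i, P i → P (i - 1)) {i₀ : ZMod n} (h₀ : P i₀) (j : ZMod n) : P j := by
  have h := forall_of_add_one (P := fun i => P (-i)) (i₀ := -i₀)
    (fun i hi => by simpa [sub_eq_add_neg, add_comm] using hstep _ hi) (by simpa using h₀) (-j)
  simpa using h

theorem prod_shift {n : ℕ} [NeZero n] {M : Type*} [CommMonoid M] (f : ZMod n → M) :
    ∏ i, f (i + 1) = ∏ i, f i :=
  Equiv.prod_comp (Equiv.addRight 1) f

theorem sum_shift {n : ℕ} [NeZero n] {M : Type*} [AddCommMonoid M] (f : ZMod n → M) :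
    ∑ i, f (i + 1) = ∑ i, f i :=
  Equiv.sum_comp (Equiv.addRight 1) f

theorem prod_ratio {n : ℕ} [NeZero n] {u : ZMod n → ℂ} (hu : ∀ i, u i ≠ 0) :
    ∏ i, u (i + 1) / u i = 1 := by
  rw [Finset.prod_div_distrib, prod_shift u]
  exact div_self (Finset.prod_ne_zero_iff.2 fun i _ => hu i)

theorem uniGenC_transpose_mulVec {n : ℕ} [NeZero n] (hn : 3 ≤ n) (kp km : ZMod n → ℝ)
    (u : ZMod n → ℂ) (i : ZMod n) :
    ((uniGenC n kp km)ᵀ *ᵥ u) i =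
      kp i * (u (i + 1) - u i) + km i * (u (i - 1) - u i) := by
  have h1 : (1 : ZMod n) ≠ 0 := by
    intro h
    have := (ZMod.natCast_eq_zero_iff 1 n).1 (by exact_mod_cast h)
    have := Nat.le_of_dvd (by norm_num) this
    omega
  have h2 : (2 : ZMod n) ≠ 0 := by
    intro h
    have := (ZMod.natCast_eq_zero_iff 2 n).1 (by exact_mod_cast h)
    have := Nat.le_of_dvd (by norm_num) this
    omega
  have ha : i + 1 ≠ i := by simpa using h1
  have hb : i - 1 ≠ i := by simpa using h1
  have hc : i - 1 ≠ i + 1 := by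
    intro h
    apply h2
    linear_combination -h
  have key : ∀ j, (uniGenC n kp km)ᵀ i j * u j =
      (if j = i + 1 then kp i * u j else 0) + (if j = i - 1 then km i * u j else 0) +
        (if j = i then -((kp i : ℂ) + km i) * u j else 0) := by
    intro j
    simp only [uniGenC, Matrix.transpose_apply, Matrix.of_apply]
    by_cases e1 : j = i + 1
    · subst e1; simp [ha, hc.symm]
    · by_cases e2 : j = i - 1
      · subst e2; simp [hb, hc]
      · by_cases e3 : j = i
        · subst e3; simp [ha.symm, hb.symm]
        · simp [e1, e2, e3]
  simp only [Matrix.mulVec, dotProduct, key, Finset.sum_add_distrib, Finset.sum_ite_eq',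
    Finset.mem_univ, if_true]
  ring

/-- The oriented area spanned by consecutive components of an eigenvector is positive. -/
theorem cross_pos {n : ℕ} [NeZero n] {kp km : ZMod n → ℝ} (hkp : ∀ i, 0 < kp i)
    (hkm : ∀ i, 0 ≤ km i) (hprod : ∏ i, km i ≤ ∏ i, kp i) {lam : ℂ} (hlam : 0 < lam.im)
    {u : ZMod n → ℂ} (hu : u ≠ 0)
    (heig : ∀ i, kp i * (u (i + 1) - u i) + km i * (u (i - 1) - u i) = lam * u i)
    (i : ZMod n) : 0 < (u i).re * (u (i + 1)).im - (u i).im * (u (i + 1)).re := by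
  set W : ZMod n → ℝ := fun i => (u i).re * (u (i + 1)).im - (u i).im * (u (i + 1)).re with hW
  have hbal : ∀ i, lam.im * Complex.normSq (u i) = kp i * W i - km i * W (i - 1) := by
    intro i
    have hre := congrArg Complex.re (heig i)
    have him := congrArg Complex.im (heig i)
    simp at hre him
    simp only [hW, sub_add_cancel, Complex.normSq_apply]
    linear_combination (u i).im * hre - (u i).re * him
  have hne : ∀ i, W i ≠ 0 → u i ≠ 0 := by
    intro i h h0
    simp [hW, h0] at h
  have hneg : ∀ i, W i < 0 → 0 < km i ∧ W (i - 1) < 0 := by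
    intro i hi
    have h1 : 0 < lam.im * Complex.normSq (u i) :=
      mul_pos hlam (Complex.normSq_pos.2 (hne i hi.ne))
    have h2 : kp i * W i < 0 := mul_neg_of_pos_of_neg (hkp i) hi
    have h3 : km i * W (i - 1) < 0 := by linarith [hbal i]
    have h4 : 0 < km i := (hkm i).lt_of_ne (by rintro h; simp [← h] at h3)
    exact ⟨h4, by by_contra! h; nlinarith⟩
  by_cases hex : ∃ j, W j < 0
  · exfalso
    obtain ⟨j, hj⟩ := hex
    have hall : ∀ i, W i < 0 := forall_of_sub_one (fun i hi => (hneg i hi).2) hj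
    have hlt : ∏ i, kp (i + 1) * -W (i + 1) < ∏ i, km (i + 1) * -W i := by
      apply Finset.prod_lt_prod_of_nonempty
      · intro i _
        exact mul_pos (hkp _) (by linarith [hall (i + 1)])
      · intro i _
        have h1 : 0 < lam.im * Complex.normSq (u (i + 1)) :=
          mul_pos hlam (Complex.normSq_pos.2 (hne _ (hall _).ne))
        have := hbal (i + 1)
        rw [add_sub_cancel_right] at this
        linarith
      · exact Finset.univ_nonempty
    rw [Finset.prod_mul_distrib, Finset.prod_mul_distrib, prod_shift kp, prod_shift km,
      prod_shift (fun i => -W i)] at hlt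
    have hWp : 0 < ∏ i, -W i := Finset.prod_pos fun i _ => by linarith [hall i]
    nlinarith
  · push Not at hex
    refine (hex i).lt_of_ne fun h0 => hu ?_
    have hzero : ∀ j, 0 = W j → u j = 0 := by
      intro j hj
      have h1 := hbal j
      rw [← hj] at h1
      have h2 := mul_nonneg (hkm j) (hex (j - 1))
      have h3 : Complex.normSq (u j) ≤ 0 := by
        by_contra! h
        nlinarith [mul_pos hlam h]
      exact Complex.normSq_eq_zero.1 (le_antisymm h3 (Complex.normSq_nonneg _))
    have hall : ∀ j, 0 = W j := forall_of_sub_one (fun j hj => by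
      simp [hW, hzero j hj]) h0
    funext j
    exact hzero j (hall j)

/-- The cyclic recurrence `aᵢ yᵢ - bᵢ yᵢ₊₁ = 1` has a positive solution when `∏ b < ∏ a`. -/
theorem exists_pos_weights {n : ℕ} [NeZero n] {a b : ZMod n → ℝ} (ha : ∀ i, 0 < a i)
    (hb : ∀ i, 0 ≤ b i) (hab : ∏ i, b i < ∏ i, a i) :
    ∃ y : ZMod n → ℝ, (∀ i, 0 < y i) ∧ ∀ i, a i * y i - b i * y (i + 1) = 1 := by
  let L : (ZMod n → ℝ) →ₗ[ℝ] (ZMod n → ℝ) :=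
    { toFun := fun y i => a i * y i - b i * y (i + 1)
      map_add' := fun y y' => by funext i; simp; ring
      map_smul' := fun c y => by funext i; simp; ring }
  have hnotneg : ∀ y : ZMod n → ℝ, (∀ i, y i < 0) → (∀ i, 0 ≤ a i * y i - b i * y (i + 1)) →
      False := by
    intro y hy h
    have hle : ∏ i, a i * -y i ≤ ∏ i, b i * -y (i + 1) := by
      apply Finset.prod_le_prod
      · intro i _
        exact mul_nonneg (ha i).le (by linarith [hy i])
      · intro i _
        linarith [h i]
    rw [Finset.prod_mul_distrib, Finset.prod_mul_distrib, prod_shift (fun i => -y i)] at hle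
    have hyp : 0 < ∏ i, -y i := Finset.prod_pos fun i _ => by linarith [hy i]
    nlinarith
  have hstep : ∀ y : ZMod n → ℝ, (∀ i, 0 ≤ a i * y i - b i * y (i + 1)) →
      (∀ i, y i < 0 → y (i + 1) < 0) → ∀ i, 0 ≤ y i := by
    intro y h h' i
    by_contra! hi
    exact hnotneg y (forall_of_add_one h' hi) h
  have hlt : ∀ y : ZMod n → ℝ, ∀ i, y i < 0 → 0 ≤ b i * -y (i + 1) + a i * y i →
      y (i + 1) < 0 := by
    intro y i hi h
    by_contra! h1
    nlinarith [mul_nonneg (hb i) h1, mul_neg_of_pos_of_neg (ha i) hi]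
  have hnonneg : ∀ y : ZMod n → ℝ, (∀ i, 0 ≤ a i * y i - b i * y (i + 1)) → ∀ i, 0 ≤ y i :=
    fun y h => hstep y h fun i hi => hlt y i hi (by linarith [h i])
  have hinj : Function.Injective L := by
    rw [injective_iff_map_eq_zero]
    intro y hy
    have hy' : ∀ i, a i * y i - b i * y (i + 1) = 0 := fun i => congrFun hy i
    funext i
    refine le_antisymm ?_ (hnonneg y (fun i => (hy' i).ge) i)
    have := hnonneg (-y) (fun i => by simp only [Pi.neg_apply]; linarith [hy' i]) i
    simpa using this
  obtain ⟨y, hy⟩ := (LinearMap.injective_iff_surjective.1 hinj) (fun _ => 1)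
  have hy' : ∀ i, a i * y i - b i * y (i + 1) = 1 := fun i => congrFun hy i
  have hy0 := hnonneg y fun i => by rw [hy' i]; exact zero_le_one
  refine ⟨y, fun i => (hy0 i).lt_of_ne fun h => ?_, hy'⟩
  have h1 := hy' i
  rw [← h] at h1
  nlinarith [mul_nonneg (hb i) (hy0 (i + 1))]

/-- The graph of `tanh` on `[0, ∞)` lies below its tangent lines. -/
theorem tanh_le_tangent {x a : ℝ} (hx : 0 ≤ x) (ha : 0 ≤ a) :
    Real.tanh x ≤ Real.tanh a + (x - a) / Real.cosh a ^ 2 := by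
  have hcx := Real.cosh_pos x
  have hca := Real.cosh_pos a
  have hid : Real.tanh x - Real.tanh a = Real.sinh (x - a) / (Real.cosh x * Real.cosh a) := by
    rw [Real.tanh_eq_sinh_div_cosh, Real.tanh_eq_sinh_div_cosh, Real.sinh_sub]
    field_simp
  have hmain : Real.sinh (x - a) * Real.cosh a ≤ (x - a) * Real.cosh x := by
    rcases le_total a x with h | h
    · obtain ⟨d, rfl⟩ : ∃ d, x = a + d := ⟨x - a, by ring⟩
      have hd : 0 ≤ d := by linarith
      have hsd : Real.sinh d ≤ d * Real.cosh d := by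
        have hmono : MonotoneOn (fun t => t * Real.cosh t - Real.sinh t) (Set.Ici 0) := by
          apply monotoneOn_of_deriv_nonneg (convex_Ici 0)
          · fun_prop
          · fun_prop
          · intro t ht
            simp only [interior_Ici, Set.mem_Ioi] at ht
            have : HasDerivAt (fun t => t * Real.cosh t - Real.sinh t)
                (1 * Real.cosh t + t * Real.sinh t - Real.cosh t) t :=
              ((hasDerivAt_id t).mul (Real.hasDerivAt_cosh t)).sub (Real.hasDerivAt_sinh t)
            rw [this.deriv]
            nlinarith [Real.sinh_pos_iff.2 ht]
        have := hmono (Set.self_mem_Ici) hd hd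
        simp at this
        exact this
      rw [add_sub_cancel_left, Real.cosh_add]
      have h1 := Real.sinh_nonneg_iff.2 hd
      have h2 := Real.sinh_nonneg_iff.2 ha
      nlinarith [mul_nonneg hd (mul_nonneg h2 h1)]
    · have h1 : Real.sinh (x - a) ≤ x - a := Real.sinh_le_self_iff.2 (by linarith)
      have h2 : Real.cosh x ≤ Real.cosh a := by
        rw [Real.cosh_le_cosh, abs_of_nonneg hx, abs_of_nonneg ha]; exact h
      nlinarith
  have : Real.sinh (x - a) / (Real.cosh x * Real.cosh a) ≤ (x - a) / Real.cosh a ^ 2 := by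
    rw [div_le_div_iff₀ (by positivity) (by positivity)]
    nlinarith
  linarith

theorem sum_tanh_le {ι : Type*} [Fintype ι] [Nonempty ι] {f : ι → ℝ} (hf : ∀ i, 0 ≤ f i) :
    ∑ i, Real.tanh (f i) ≤ Fintype.card ι * Real.tanh ((∑ i, f i) / Fintype.card ι) := by
  have hc : (0 : ℝ) < Fintype.card ι := by exact_mod_cast Fintype.card_pos
  have h := Finset.sum_le_sum fun i (_ : i ∈ Finset.univ) =>
    tanh_le_tangent (hf i) (div_nonneg (Finset.sum_nonneg fun i _ => hf i) hc.le :
      0 ≤ (∑ i, f i) / Fintype.card ι)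
  rw [Finset.sum_add_distrib, ← Finset.sum_div, Finset.sum_sub_distrib] at h
  simp only [Finset.sum_const, Finset.card_univ, nsmul_eq_mul, mul_div_cancel₀ _ hc.ne',
    sub_self, zero_div, add_zero] at h
  exact h

theorem sin_mul_cos_le {x a : ℝ} (hx : x ∈ Set.Icc 0 (Real.pi / 2))
    (ha : a ∈ Set.Icc 0 (Real.pi / 2)) :
    Real.sin x * Real.cos x ≤
      2 * Real.sin a * Real.cos x - Real.sin a * Real.cos a + (x - a) := by
  set h : ℝ → ℝ := fun t => 2 * Real.sin a * Real.cos t + t - Real.sin t * Real.cos t with hh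
  have hd : ∀ t, HasDerivAt h (2 * Real.sin t * (Real.sin t - Real.sin a)) t := by
    intro t
    have := (((Real.hasDerivAt_cos t).const_mul (2 * Real.sin a)).add (hasDerivAt_id t)).sub
      ((Real.hasDerivAt_sin t).mul (Real.hasDerivAt_cos t))
    refine this.congr_deriv ?_
    linear_combination -Real.sin_sq_add_cos_sq t
  have hcont : Continuous h := by fun_prop
  suffices h a ≤ h x by simp only [hh] at this; linarith
  have hpi := Real.pi_pos
  rcases le_total a x with hax | hax
  · have hm : MonotoneOn h (Set.Icc a x) := by
      apply monotoneOn_of_deriv_nonneg (convex_Icc a x) hcont.continuousOn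
      · exact fun t _ => (hd t).differentiableAt.differentiableWithinAt
      · intro t ht
        rw [interior_Icc] at ht
        rw [(hd t).deriv]
        have h1 : 0 ≤ Real.sin t :=
          Real.sin_nonneg_of_nonneg_of_le_pi (by linarith [ha.1, ht.1]) (by linarith [hx.2, ht.2])
        have h2 : Real.sin a ≤ Real.sin t :=
          Real.sin_le_sin_of_le_of_le_pi_div_two (by linarith [ha.1]) (by linarith [hx.2, ht.2])
            ht.1.le
        exact mul_nonneg (by linarith) (by linarith)
    exact hm (Set.left_mem_Icc.2 hax) (Set.right_mem_Icc.2 hax) hax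
  · have hm : AntitoneOn h (Set.Icc x a) := by
      apply antitoneOn_of_deriv_nonpos (convex_Icc x a) hcont.continuousOn
      · exact fun t _ => (hd t).differentiableAt.differentiableWithinAt
      · intro t ht
        rw [interior_Icc] at ht
        rw [(hd t).deriv]
        have h1 : 0 ≤ Real.sin t :=
          Real.sin_nonneg_of_nonneg_of_le_pi (by linarith [hx.1, ht.1]) (by linarith [ha.2, ht.2])
        have h2 : Real.sin t ≤ Real.sin a :=
          Real.sin_le_sin_of_le_of_le_pi_div_two (by linarith [hx.1, ht.1]) ha.2 ht.2.le
        exact mul_nonpos_of_nonneg_of_nonpos (by linarith) (by linarith)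
    exact hm (Set.left_mem_Icc.2 hax) (Set.right_mem_Icc.2 hax) hax

/-- The trigonometric inequality behind the bound: `θᵢ` are the phase increments and `τᵢ` the
edgewise force factors. -/
theorem sum_sin_le {ι : Type*} [Fintype ι] [Nonempty ι] {θ τ : ι → ℝ} {T η : ℝ}
    (hθ : ∀ i, θ i ∈ Set.Ioo 0 Real.pi) (hτ : ∀ i, 0 < τ i) (hT : 0 < T)
    (hτT : ∑ i, τ i ≤ Fintype.card ι * T) (hη : ∑ i, θ i = Fintype.card ι * (2 * η)) :
    ∑ i, Real.sin (θ i) ≤ T * Real.tan η * ∑ i, (1 + Real.cos (θ i)) / τ i := by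
  have hpi := Real.pi_pos
  have hc : (0 : ℝ) < Fintype.card ι := by exact_mod_cast Fintype.card_pos
  have hη0 : 0 < η := by
    have : 0 < ∑ i, θ i := Finset.sum_pos (fun i _ => (hθ i).1) Finset.univ_nonempty
    rw [hη] at this
    have := pos_of_mul_pos_right this hc.le
    linarith
  have hη1 : η < Real.pi / 2 := by
    have : ∑ i, θ i < ∑ _i : ι, Real.pi :=
      Finset.sum_lt_sum_of_nonempty Finset.univ_nonempty fun i _ => (hθ i).2
    rw [hη, Finset.sum_const, Finset.card_univ, nsmul_eq_mul] at this
    have := lt_of_mul_lt_mul_left this hc.le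
    linarith
  have hcos : 0 < Real.cos η := Real.cos_pos_of_mem_Ioo ⟨by linarith, hη1⟩
  have hsin : 0 < Real.sin η := Real.sin_pos_of_pos_of_lt_pi hη0 (by linarith)
  have htan : Real.tan η * Real.cos η = Real.sin η := Real.tan_mul_cos hcos.ne'
  have htan0 : 0 < Real.tan η := Real.tan_pos_of_pos_of_lt_pi_div_two hη0 hη1
  have hpt : ∀ i, Real.sin (θ i) + 2 * Real.sin η * Real.cos η ≤
      T * Real.tan η * ((1 + Real.cos (θ i)) / τ i) +
        2 * Real.sin η * Real.cos η / T * τ i + (θ i - 2 * η) := by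
    intro i
    have ht := hτ i
    set x := θ i / 2 with hx
    have hθx : θ i = 2 * x := by rw [hx]; ring
    have h1 := sin_mul_cos_le (x := x) (a := η) ⟨by linarith [(hθ i).1], by linarith [(hθ i).2]⟩
      ⟨hη0.le, hη1.le⟩
    have h2 : 4 * Real.sin η * Real.cos x ≤ T * Real.tan η * ((1 + Real.cos (θ i)) / τ i) +
        2 * Real.sin η * Real.cos η / T * τ i := by
      have : T * Real.tan η * ((1 + Real.cos (θ i)) / τ i) +
          2 * Real.sin η * Real.cos η / T * τ i - 4 * Real.sin η * Real.cos x =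
          2 * Real.tan η / (T * τ i) * (T * Real.cos x - Real.cos η * τ i) ^ 2 := by
        rw [hθx, Real.cos_two_mul, ← htan]
        field_simp
        ring
      have h3 : 0 ≤ 2 * Real.tan η / (T * τ i) * (T * Real.cos x - Real.cos η * τ i) ^ 2 := by
        positivity
      linarith
    have h4 : Real.sin (θ i) = 2 * (Real.sin x * Real.cos x) := by
      rw [hθx, Real.sin_two_mul]; ring
    linarith
  have hsum := Finset.sum_le_sum fun i (_ : i ∈ Finset.univ) => hpt i
  simp only [Finset.sum_add_distrib, Finset.sum_sub_distrib, ← Finset.mul_sum, Finset.sum_const,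
    Finset.card_univ, nsmul_eq_mul, hη] at hsum
  have hlast : 2 * Real.sin η * Real.cos η / T * ∑ i, τ i ≤
      Fintype.card ι * (2 * Real.sin η * Real.cos η) := by
    calc _ ≤ 2 * Real.sin η * Real.cos η / T * (Fintype.card ι * T) := by gcongr
      _ = _ := by field_simp
  linarith

theorem tanh_half_log {q : ℝ} (hq : 0 < q) : Real.tanh (Real.log q / 2) = (q - 1) / (q + 1) := by
  have hsq : Real.exp (Real.log q / 2) ^ 2 = q := by
    rw [← Real.exp_nat_mul]
    push_cast
    rw [mul_div_cancel₀ _ two_ne_zero, Real.exp_log hq]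
  have hE := Real.exp_pos (Real.log q / 2)
  rw [Real.tanh_eq_sinh_div_cosh, Real.sinh_eq, Real.cosh_eq, Real.exp_neg]
  set E := Real.exp (Real.log q / 2)
  rw [← hsq]
  field_simp

theorem sum_inv_add_le {n : ℕ} [NeZero n] {kp km ρ y : ZMod n → ℝ} (hkp : ∀ i, 0 < kp i)
    (hkm : ∀ i, 0 ≤ km i) (hρ : ∀ i, 0 < ρ i) (hρ1 : ∑ i, Real.log (ρ i) = 0)
    (hy : ∀ i, 0 < y i)
    (hflux : ∀ i, kp i * ρ i * y i - km (i + 1) / ρ i * y (i + 1) = 1) :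
    ∑ i, (kp i * ρ i * y i + km (i + 1) / ρ i * y (i + 1))⁻¹ ≤ n * uniT n kp km := by
  set M : ZMod n → ℝ := fun i => kp i * ρ i * y i with hM
  set N : ZMod n → ℝ := fun i => km (i + 1) / ρ i * y (i + 1) with hN
  change ∀ i, M i - N i = 1 at hflux
  change ∑ i, (M i + N i)⁻¹ ≤ _
  have hMpos : ∀ i, 0 < M i := fun i => mul_pos (mul_pos (hkp i) (hρ i)) (hy i)
  have hNnonneg : ∀ i, 0 ≤ N i := fun i =>
    mul_nonneg (div_nonneg (hkm _) (hρ i).le) (hy _).le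
  unfold uniT
  split_ifs with h
  · have hkm' : ∀ i, 0 < km i := fun i => (hkm i).lt_of_ne (h i).symm
    have hNpos : ∀ i, 0 < N i := fun i => mul_pos (div_pos (hkm' _) (hρ i)) (hy _)
    have hτ : ∀ i, (M i + N i)⁻¹ = Real.tanh (Real.log (M i / N i) / 2) := by
      intro i
      have := hNpos i
      have := hMpos i
      rw [tanh_half_log (div_pos (hMpos i) (hNpos i))]
      field_simp
      exact (hflux i).symm
    have hsum : ∑ i, Real.log (M i / N i) / 2 = (∑ i, Real.log (kp i / km i)) / 2 := by
      rw [← Finset.sum_div]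
      congr 1
      have hlog : ∀ i, Real.log (M i / N i) = Real.log (kp i) - Real.log (km (i + 1)) +
          2 * Real.log (ρ i) + (Real.log (y i) - Real.log (y (i + 1))) := by
        intro i
        have h1 := (hkp i).ne'
        have h2 := (hkm' (i + 1)).ne'
        have h3 := (hρ i).ne'
        have h4 := (hy i).ne'
        have h5 := (hy (i + 1)).ne'
        simp only [hM, hN]
        rw [Real.log_div (by positivity) (by positivity), Real.log_mul (by positivity) h4,
          Real.log_mul h1 h3, Real.log_mul (by positivity) h5, Real.log_div h2 h3]
        ring
      have hlog' : ∀ i, Real.log (kp i / km i) = Real.log (kp i) - Real.log (km i) :=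
        fun i => Real.log_div (hkp i).ne' (h i)
      simp only [hlog, hlog', Finset.sum_add_distrib, Finset.sum_sub_distrib, ← Finset.mul_sum,
        hρ1, sum_shift (fun i => Real.log (km i)), sum_shift (fun i => Real.log (y i))]
      ring
    have hle := sum_tanh_le (f := fun i => Real.log (M i / N i) / 2) fun i => by
      have : 1 ≤ M i / N i := (one_le_div (hNpos i)).2 (by linarith [hflux i])
      have := Real.log_nonneg this
      positivity
    rw [hsum, ZMod.card, div_div] at hle
    simpa only [hτ] using hle
  · calc ∑ i, (M i + N i)⁻¹ ≤ ∑ _i : ZMod n, (1 : ℝ) := by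
          refine Finset.sum_le_sum fun i _ => inv_le_one_of_one_le₀ ?_
          linarith [hflux i, hNnonneg i]
      _ = n * 1 := by simp [ZMod.card]

theorem exists_int_sum_arg {ι : Type*} [Fintype ι] {z : ι → ℂ} (hz : ∀ i, z i ≠ 0)
    (hprod : ∏ i, z i = 1) :
    ∑ i, Real.log ‖z i‖ = 0 ∧ ∃ m : ℤ, ∑ i, (z i).arg = m * (2 * Real.pi) := by
  have hexp : Complex.exp (∑ i, Complex.log (z i)) = 1 := by
    rw [Complex.exp_sum, ← hprod]
    exact Finset.prod_congr rfl fun i _ => Complex.exp_log (hz i)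
  obtain ⟨m, hm⟩ := Complex.exp_eq_one_iff.1 hexp
  have hre := congrArg Complex.re hm
  have him := congrArg Complex.im hm
  simp [Complex.log_re, Complex.log_im] at hre him
  exact ⟨hre, m, him⟩

theorem windingNum_eq {n : ℕ} [NeZero n] {u : ZMod n → ℂ} {m : ℤ}
    (h : ∑ i, (u (i + 1) / u i).arg = m * (2 * Real.pi)) : windingNum n u = wrapIdx n m := by
  rw [windingNum, h, mul_div_cancel_right₀ _ Real.two_pi_pos.ne', round_intCast]

/-- Bounds on an eigenvalue in the upper half plane in terms of the ratios `z i = u (i + 1) / u i`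
of consecutive components of the eigenvector. -/
theorem ratio_bound {n : ℕ} [NeZero n] {kp km : ZMod n → ℝ} (hkp : ∀ i, 0 < kp i)
    (hkm : ∀ i, 0 ≤ km i) {r : ℝ} (hr : ∀ i, kp i + km i ≤ r)
    {lam : ℂ} (hlam : 0 < lam.im) {z : ZMod n → ℂ} (hz : ∀ i, 0 < (z i).im)
    (hz1 : ∏ i, z i = 1)
    (heig : ∀ i, lam = kp i * (z i - 1) + km i * ((z (i - 1))⁻¹ - 1)) {m : ℤ}
    (hm : ∑ i, (z i).arg = m * (2 * Real.pi)) :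
    (-(2 * r) < lam.re ∧ lam.re < 0) ∧
      lam.im / (2 * r + lam.re) ≤ uniT n kp km * Real.tan (Real.pi * m / n) := by
  have hz0 : ∀ i, z i ≠ 0 := fun i h => by have := hz i; simp [h] at this
  set ρ : ZMod n → ℝ := fun i => ‖z i‖ with hρdef
  set θ : ZMod n → ℝ := fun i => (z i).arg with hθdef
  have hρ : ∀ i, 0 < ρ i := fun i => norm_pos_iff.2 (hz0 i)
  have hre : ∀ i, (z i).re = ρ i * Real.cos (θ i) := fun i =>
    (Complex.norm_mul_cos_arg (z i)).symm
  have him : ∀ i, (z i).im = ρ i * Real.sin (θ i) := fun i =>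
    (Complex.norm_mul_sin_arg (z i)).symm
  have hnsq : ∀ i, Complex.normSq (z i) = ρ i ^ 2 := fun i => Complex.normSq_eq_norm_sq _
  have hire : ∀ i, ((z i)⁻¹).re = Real.cos (θ i) / ρ i := fun i => by
    have := (hρ i).ne'
    rw [Complex.inv_re, hnsq, hre]; field_simp
  have hiim : ∀ i, ((z i)⁻¹).im = -Real.sin (θ i) / ρ i := fun i => by
    have := (hρ i).ne'
    rw [Complex.inv_im, hnsq, him]; field_simp
  have hθ : ∀ i, θ i ∈ Set.Ioo 0 Real.pi := by
    intro i
    have hs : 0 < Real.sin (θ i) := pos_of_mul_pos_right (him i ▸ hz i) (hρ i).le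
    have h0 : 0 ≤ θ i := Complex.arg_nonneg_iff.2 (hz i).le
    refine ⟨h0.lt_of_ne fun h => ?_, (Complex.arg_le_pi _).lt_of_ne fun h => ?_⟩
    · rw [← h] at hs; simp at hs
    · change θ i = _ at h
      rw [h] at hs; simp at hs
  have hlogρ : ∑ i, Real.log (ρ i) = 0 := (exists_int_sum_arg hz0 hz1).1
  have hρ1 : ∏ i, ρ i = 1 := by
    rw [hρdef, ← norm_prod, hz1, norm_one]
  have hlt : ∏ i, km i < ∏ i, kp i := by
    have hs : ∀ i, 0 < Real.sin (θ i) := fun i => Real.sin_pos_of_mem_Ioo (hθ i)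
    have hbal : ∀ i, km (i + 1) * (Real.sin (θ i) / ρ i) <
        kp (i + 1) * (ρ (i + 1) * Real.sin (θ (i + 1))) := by
      intro i
      have := congrArg Complex.im (heig (i + 1))
      simp only [Complex.add_im, Complex.im_ofReal_mul, Complex.sub_im, Complex.one_im, him,
        hiim, add_sub_cancel_right, neg_div] at this
      linarith
    by_cases h0 : ∃ i, km i = 0
    · obtain ⟨i, hi⟩ := h0
      rw [Finset.prod_eq_zero (Finset.mem_univ i) hi]
      exact Finset.prod_pos fun i _ => hkp i
    · push Not at h0
      have hp := Finset.prod_lt_prod_of_nonempty (s := Finset.univ)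
        (fun i _ => mul_pos ((hkm (i + 1)).lt_of_ne (h0 _).symm) (div_pos (hs i) (hρ i)))
        (fun i _ => hbal i) Finset.univ_nonempty
      rw [Finset.prod_mul_distrib, Finset.prod_mul_distrib, Finset.prod_div_distrib,
        prod_shift km, prod_shift kp, prod_shift (fun i => ρ i * Real.sin (θ i)),
        Finset.prod_mul_distrib, hρ1, div_one, one_mul] at hp
      exact lt_of_mul_lt_mul_right hp (Finset.prod_nonneg fun i _ => (hs i).le)
  obtain ⟨y, hy, hflux⟩ := exists_pos_weights (a := fun i => kp i * ρ i)
    (b := fun i => km (i + 1) / ρ i) (fun i => mul_pos (hkp i) (hρ i))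
    (fun i => div_nonneg (hkm _) (hρ i).le) (by
      rw [Finset.prod_mul_distrib, Finset.prod_div_distrib, hρ1, prod_shift km]
      simpa using hlt)
  set A : ZMod n → ℝ := fun i => kp i * ρ i * y i + km (i + 1) / ρ i * y (i + 1) with hA
  have hA1 : ∀ i, 1 ≤ A i := fun i => by
    have : 0 ≤ km (i + 1) / ρ i * y (i + 1) :=
      mul_nonneg (div_nonneg (hkm _) (hρ i).le) (hy _).le
    linarith [hflux i]
  have hApos : ∀ i, 0 < A i := fun i => zero_lt_one.trans_le (hA1 i)
  set Y := ∑ i, y i with hY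
  have hYpos : 0 < Y := Finset.sum_pos (fun i _ => hy i) Finset.univ_nonempty
  have hbalIm : lam.im * Y = ∑ i, Real.sin (θ i) := by
    have h1 : ∀ i, lam.im * y i = kp i * ρ i * y i * Real.sin (θ i) -
        km i / ρ (i - 1) * y i * Real.sin (θ (i - 1)) := by
      intro i
      have := congrArg Complex.im (heig i)
      simp only [Complex.add_im, Complex.im_ofReal_mul, Complex.sub_im, Complex.one_im, him,
        hiim] at this
      rw [this]
      ring
    have h2 := sum_shift fun i => km i / ρ (i - 1) * y i * Real.sin (θ (i - 1))
    simp only [add_sub_cancel_right] at h2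
    rw [hY, Finset.mul_sum, Finset.sum_congr rfl fun i _ => h1 i, Finset.sum_sub_distrib, ← h2,
      ← Finset.sum_sub_distrib]
    refine Finset.sum_congr rfl fun i _ => ?_
    linear_combination Real.sin (θ i) * hflux i
  have hbalRe : lam.re * Y + ∑ i, (kp i + km i) * y i = ∑ i, A i * Real.cos (θ i) := by
    have h1 : ∀ i, lam.re * y i + (kp i + km i) * y i = kp i * ρ i * y i * Real.cos (θ i) +
        km i / ρ (i - 1) * y i * Real.cos (θ (i - 1)) := by
      intro i
      have := congrArg Complex.re (heig i)
      simp only [Complex.add_re, Complex.re_ofReal_mul, Complex.sub_re, Complex.one_re, hre,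
        hire] at this
      rw [this]
      ring
    have h2 := sum_shift fun i => km i / ρ (i - 1) * y i * Real.cos (θ (i - 1))
    simp only [add_sub_cancel_right] at h2
    rw [hY, Finset.mul_sum, ← Finset.sum_add_distrib, Finset.sum_congr rfl fun i _ => h1 i,
      Finset.sum_add_distrib, ← h2, ← Finset.sum_add_distrib]
    refine Finset.sum_congr rfl fun i _ => ?_
    simp only [hA]
    ring
  have hescape : ∑ i, A i ≤ ∑ i, (kp i + km i) * y i := by
    have h2 := sum_shift fun i => km i * y i
    have h3 : ∀ i, A i - Real.log (ρ i) ≤ kp i * y i + km (i + 1) * y (i + 1) := by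
      intro i
      have hp := (hρ i).ne'
      have e1 : -Real.log (ρ i) + 1 ≤ (ρ i)⁻¹ := by
        have := Real.add_one_le_exp (-Real.log (ρ i))
        rwa [Real.exp_neg, Real.exp_log (hρ i)] at this
      have e2 : Real.log (ρ i) + 1 ≤ ρ i := by
        have := Real.add_one_le_exp (Real.log (ρ i))
        rwa [Real.exp_log (hρ i)] at this
      have m1 : 0 ≤ kp i * ρ i * y i := (mul_pos (mul_pos (hkp i) (hρ i)) (hy i)).le
      have m2 : 0 ≤ km (i + 1) / ρ i * y (i + 1) :=
        mul_nonneg (div_nonneg (hkm _) (hρ i).le) (hy _).le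
      have k1 := mul_le_mul_of_nonneg_left e1 m1
      have k2 := mul_le_mul_of_nonneg_left e2 m2
      have q1 : kp i * ρ i * y i * (ρ i)⁻¹ = kp i * y i := by field_simp
      have q2 : km (i + 1) / ρ i * y (i + 1) * ρ i = km (i + 1) * y (i + 1) := by field_simp
      rw [q1] at k1
      rw [q2] at k2
      have := congrArg (Real.log (ρ i) * ·) (hflux i)
      simp only [hA]
      linarith
    have h4 := Finset.sum_le_sum fun i (_ : i ∈ Finset.univ) => h3 i
    rw [Finset.sum_sub_distrib, hlogρ, sub_zero] at h4
    refine h4.trans_eq ?_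
    simp only [add_mul, Finset.sum_add_distrib, h2]
  have hrY : ∑ i, (kp i + km i) * y i ≤ r * Y := by
    rw [hY, Finset.mul_sum]
    exact Finset.sum_le_sum fun i _ => mul_le_mul_of_nonneg_right (hr i) (hy i).le
  have hcos : ∀ i, -1 < Real.cos (θ i) ∧ Real.cos (θ i) < 1 := by
    intro i
    have h1 := Real.cos_lt_cos_of_nonneg_of_le_pi (hθ i).1.le le_rfl (hθ i).2
    have h2 := Real.cos_lt_cos_of_nonneg_of_le_pi le_rfl (hθ i).2.le (hθ i).1
    rw [Real.cos_pi] at h1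
    rw [Real.cos_zero] at h2
    exact ⟨h1, h2⟩
  set S := ∑ i, (1 + Real.cos (θ i)) / (A i)⁻¹ with hS
  have hSeq : S = ∑ i, A i + ∑ i, A i * Real.cos (θ i) := by
    rw [hS, ← Finset.sum_add_distrib]
    refine Finset.sum_congr rfl fun i _ => ?_
    rw [div_inv_eq_mul]
    ring
  have hSpos : 0 < S := Finset.sum_pos
    (fun i _ => div_pos (by linarith [(hcos i).1]) (inv_pos.2 (hApos i))) Finset.univ_nonempty
  have hSle : S ≤ (2 * r + lam.re) * Y := by linarith
  have hG : 0 < 2 * r + lam.re := pos_of_mul_pos_left (hSpos.trans_le hSle) hYpos.le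
  have hneg : lam.re * Y < 0 := by
    have : ∑ i, A i * Real.cos (θ i) < ∑ i, A i := Finset.sum_lt_sum_of_nonempty
      Finset.univ_nonempty fun i _ => mul_lt_of_lt_one_right (hApos i) (hcos i).2
    linarith
  have hτT := sum_inv_add_le hkp hkm hρ hlogρ hy hflux
  have hn : (0 : ℝ) < n := by exact_mod_cast Nat.pos_of_ne_zero (NeZero.ne n)
  have hT : 0 < uniT n kp km := by
    have : 0 < ∑ i, (A i)⁻¹ :=
      Finset.sum_pos (fun i _ => inv_pos.2 (hApos i)) Finset.univ_nonempty
    exact pos_of_mul_pos_right (this.trans_le hτT) hn.le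
  have hmain := sum_sin_le (θ := θ) (τ := fun i => (A i)⁻¹) (η := Real.pi * m / n) hθ
    (fun i => inv_pos.2 (hApos i)) hT (by rwa [ZMod.card]) (by
      rw [ZMod.card, hθdef, hm]; field_simp)
  refine ⟨⟨by linarith, neg_of_mul_neg_left hneg hYpos.le⟩, ?_⟩
  rw [div_le_iff₀ hG]
  have htan : 0 ≤ uniT n kp km * Real.tan (Real.pi * m / n) := by
    have h1 : 0 < ∑ i, Real.sin (θ i) :=
      Finset.sum_pos (fun i _ => Real.sin_pos_of_mem_Ioo (hθ i)) Finset.univ_nonempty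
    exact (pos_of_mul_pos_left (h1.trans_le hmain) hSpos.le).le
  refine le_of_mul_le_mul_right ?_ hYpos
  calc lam.im * Y ≤ uniT n kp km * Real.tan (Real.pi * m / n) * S := hbalIm ▸ hmain
    _ ≤ uniT n kp km * Real.tan (Real.pi * m / n) * ((2 * r + lam.re) * Y) :=
      mul_le_mul_of_nonneg_left hSle htan
    _ = _ := by ring

theorem wrapIdx_neg (n : ℕ) (m : ℤ) : wrapIdx n (-m) = wrapIdx n m := by
  have h1 : ((n : ℤ) - m) % n = -m % n := by
    rw [sub_eq_add_neg, Int.add_emod_left]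
  have h2 : ((n : ℤ) - -m) % n = m % n := by
    rw [sub_neg_eq_add, Int.add_emod_left]
  rw [wrapIdx, wrapIdx, h1, h2, min_comm]

theorem wrapIdx_of_pos {n : ℕ} {m : ℤ} (h0 : 0 < m) (h1 : 2 * m < n) : wrapIdx n m = m := by
  rw [wrapIdx, Int.emod_eq_of_lt h0.le (by omega), Int.emod_eq_of_lt (by omega) (by omega)]
  omega

theorem windingNum_conj {n : ℕ} [NeZero n] {u : ZMod n → ℂ} (hu : ∀ i, u i ≠ 0)
    (him : ∀ i, (u (i + 1) / u i).im ≠ 0) :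
    windingNum n (fun i => starRingEnd ℂ (u i)) = windingNum n u := by
  obtain ⟨m, hm⟩ := (exists_int_sum_arg (z := fun i => u (i + 1) / u i)
    (fun i => div_ne_zero (hu _) (hu _)) (prod_ratio hu)).2
  rw [windingNum_eq hm, ← wrapIdx_neg]
  apply windingNum_eq
  have harg : ∀ i, (u (i + 1) / u i).arg ≠ Real.pi := fun i h =>
    him i (Complex.arg_eq_pi_iff.1 h).2
  simp only [← map_div₀, Complex.arg_conj, harg, if_false, Finset.sum_neg_distrib, hm]
  push_cast
  ring

theorem dual_bound_of_im_pos {n : ℕ} [NeZero n] {kp km : ZMod n → ℝ} (hkp : ∀ i, 0 < kp i)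
    (hkm : ∀ i, 0 ≤ km i) (hprod : ∏ i, km i ≤ ∏ i, kp i) {r : ℝ} (hr : ∀ i, kp i + km i ≤ r)
    {lam : ℂ} (hlam : 0 < lam.im) {u : ZMod n → ℂ} (hu : u ≠ 0)
    (heig : ∀ i, kp i * (u (i + 1) - u i) + km i * (u (i - 1) - u i) = lam * u i) :
    (∀ i, u i ≠ 0 ∧ 0 < (u (i + 1) / u i).im) ∧
    (-(2 * r) < lam.re ∧ lam.re < 0) ∧
    (1 ≤ windingNum n u ∧ windingNum n u ≤ ((n : ℤ) + 1) / 2 - 1) ∧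
    lam.im / (2 * r + lam.re) ≤
      uniT n kp km * Real.tan (Real.pi * (windingNum n u : ℝ) / n) := by
  have hcross := cross_pos hkp hkm hprod hlam hu heig
  have hne : ∀ i, u i ≠ 0 := fun i h => by have := hcross i; simp [h] at this
  have him : ∀ i, 0 < (u (i + 1) / u i).im := by
    intro i
    have hns := Complex.normSq_pos.2 (hne i)
    rw [Complex.div_im, ← sub_div]
    exact div_pos (by linarith [hcross i]) hns
  have hz0 : ∀ i, u (i + 1) / u i ≠ 0 := fun i => div_ne_zero (hne _) (hne _)
  have hz1 := prod_ratio hne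
  obtain ⟨m, hm⟩ := (exists_int_sum_arg hz0 hz1).2
  have hpi := Real.pi_pos
  have hm0 : 0 < m := by
    have : 0 < ∑ i, (u (i + 1) / u i).arg := Finset.sum_pos (fun i _ =>
      (Complex.arg_nonneg_iff.2 (him i).le).lt_of_ne fun h =>
        (him i).ne' (Complex.arg_eq_zero_iff.1 h.symm).2) Finset.univ_nonempty
    rw [hm] at this
    exact_mod_cast pos_of_mul_pos_left this (by positivity)
  have hmn : 2 * m < n := by
    have : ∑ i, (u (i + 1) / u i).arg < ∑ _i : ZMod n, Real.pi :=
      Finset.sum_lt_sum_of_nonempty Finset.univ_nonempty fun i _ =>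
        (Complex.arg_le_pi _).lt_of_ne fun h => (him i).ne' (Complex.arg_eq_pi_iff.1 h).2
    rw [hm, Finset.sum_const, Finset.card_univ, ZMod.card, nsmul_eq_mul] at this
    have : (2 * m : ℝ) < n := lt_of_mul_lt_mul_right (by linarith) hpi.le
    exact_mod_cast this
  rw [windingNum_eq hm, wrapIdx_of_pos hm0 hmn]
  obtain ⟨hre, hbound⟩ := ratio_bound hkp hkm hr hlam him hz1 (fun i => by
    have h1 := hne i
    have h2 := hne (i - 1)
    rw [sub_add_cancel]
    field_simp
    linear_combination -heig i) hm
  exact ⟨fun i => ⟨hne i, him i⟩, hre, ⟨by omega, by omega⟩, hbound⟩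

theorem prod_le_prod_of_affinity_nonneg {ι : Type*} [Fintype ι] {kp km : ι → ℝ}
    (hkp : ∀ i, 0 < kp i) (hkm : ∀ i, 0 ≤ km i)
    (hF : (∀ i, km i ≠ 0) → 0 ≤ ∑ i, Real.log (kp i / km i)) : ∏ i, km i ≤ ∏ i, kp i := by
  have hP : 0 < ∏ i, kp i := Finset.prod_pos fun i _ => hkp i
  by_cases h : ∀ i, km i ≠ 0
  · have hkm' : ∀ i, 0 < km i := fun i => (hkm i).lt_of_ne (h i).symm
    have hF' := hF h
    rw [← Real.log_prod fun i _ => (div_pos (hkp i) (hkm' i)).ne', Finset.prod_div_distrib,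
      Real.log_nonneg_iff (div_pos hP (Finset.prod_pos fun i _ => hkm' i)),
      one_le_div (Finset.prod_pos fun i _ => hkm' i)] at hF'
    exact hF'
  · push Not at h
    obtain ⟨i, hi⟩ := h
    rw [Finset.prod_eq_zero (Finset.mem_univ i) hi]
    exact hP.le

end Unicyclic

theorem unicyclic_dual_bound
    (n : ℕ) [NeZero n] (hn : 3 ≤ n)
    (kp km : ZMod n → ℝ) (hkp : ∀ i, 0 < kp i) (hkm : ∀ i, 0 ≤ km i)
    (hF : (∀ i, km i ≠ 0) → 0 ≤ ∑ i : ZMod n, Real.log (kp i / km i))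
    (r : ℝ) (hr : IsGreatest (Set.range fun i : ZMod n => kp i + km i) r)
    (lam : ℂ) (hlam : lam.im ≠ 0)
    (u : ZMod n → ℂ) (hu : u ≠ 0)
    (heig : (uniGenC n kp km)ᵀ *ᵥ u = lam • u) :
    (-(2 * r) < lam.re ∧ lam.re < 0) ∧
    (∀ i, u i ≠ 0) ∧
    (1 ≤ windingNum n u ∧ windingNum n u ≤ ((n : ℤ) + 1) / 2 - 1) ∧
    |lam.im| / (2 * r + lam.re) ≤
      uniT n kp km * Real.tan (Real.pi * (windingNum n u : ℝ) / n) := by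
  have hprod := Unicyclic.prod_le_prod_of_affinity_nonneg hkp hkm hF
  have hr' : ∀ i, kp i + km i ≤ r := fun i => hr.2 ⟨i, rfl⟩
  have heig' : ∀ i, kp i * (u (i + 1) - u i) + km i * (u (i - 1) - u i) = lam * u i := fun i => by
    rw [← Unicyclic.uniGenC_transpose_mulVec hn, heig, Pi.smul_apply, smul_eq_mul]
  rcases hlam.lt_or_gt with h | h
  · have hconj := Unicyclic.dual_bound_of_im_pos hkp hkm hprod hr' (lam := starRingEnd ℂ lam)
      (u := fun i => starRingEnd ℂ (u i)) (by simpa using h)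
      (fun h0 => hu (funext fun i => by simpa using congrFun h0 i))
      (fun i => by simpa using congrArg (starRingEnd ℂ) (heig' i))
    simp only [← map_div₀, Complex.conj_re, Complex.conj_im, Left.neg_pos_iff] at hconj
    obtain ⟨hu', hre, hw, hbound⟩ := hconj
    have hne : ∀ i, u i ≠ 0 := fun i h0 => (hu' i).1 (by simp [h0])
    rw [Unicyclic.windingNum_conj hne fun i => (hu' i).2.ne] at hw hbound
    rw [abs_of_neg h]
    exact ⟨hre, hne, hw, hbound⟩
  · obtain ⟨hu', hre, hw, hbound⟩ :=
      Unicyclic.dual_bound_of_im_pos hkp hkm hprod hr' h hu heig'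
    rw [abs_of_pos h]
    exact ⟨hre, fun i => (hu' i).1, hw, hbound⟩
end

section
/- Let R be the unicyclic generator on n ≥ 3 states with rates k⁺ᵢ > 0, k⁻ᵢ ≥ 0, cycle affinity F ≥ 0 and maximum escape rate r. Then every nonreal eigenvalue λ of R satisfies −2r < Re λ < 0 and |Im λ| ≤ T · √((−Re λ)(2r + Re λ)); that is, λ lies in the ellipse centered at −r with horizontal semi-axis r and vertical semi-axis r·T. -/
open Matrix Finset

theorem two_mul_sub_div_le_log_sub {t T : ℝ} (ht : 0 ≤ t) (ht1 : t < 1) (hT : 0 ≤ T)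
    (hT1 : T < 1) :
    2 * (t - T) / (1 - T ^ 2) ≤
      (Real.log (1 + t) - Real.log (1 - t)) - (Real.log (1 + T) - Real.log (1 - T)) := by
  set f : ℝ → ℝ := fun x => Real.log (1 + x) - Real.log (1 - x) with hf
  have hd : ∀ x, 0 ≤ x → x < 1 → HasDerivAt f (2 / (1 - x ^ 2)) x := by
    intro x h0 h1
    have e1 : HasDerivAt (fun x : ℝ => 1 + x) 1 x := (hasDerivAt_id x).const_add 1
    have e2 : HasDerivAt (fun x : ℝ => 1 - x) (-1) x := (hasDerivAt_id x).const_sub 1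
    have n1 : 1 + x ≠ 0 := by linarith
    have n2 : 1 - x ≠ 0 := by linarith
    refine ((e1.log n1).sub (e2.log n2)).congr_deriv ?_
    have n3 : 1 - x ^ 2 ≠ 0 := by
      have : 1 - x ^ 2 = (1 + x) * (1 - x) := by ring
      rw [this]; exact mul_ne_zero n1 n2
    field_simp
    ring
  have hpos : ∀ x : ℝ, 0 ≤ x → x < 1 → 0 < 1 - x ^ 2 := fun x h0 h1 => by nlinarith
  change _ ≤ f t - f T
  rcases lt_trichotomy t T with h | h | h
  · obtain ⟨c, ⟨hc1, hc2⟩, hc⟩ := exists_hasDerivAt_eq_slope f (fun x => 2 / (1 - x ^ 2)) h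
      (fun x hx => (hd x (by linarith [hx.1]) (by linarith [hx.2])).continuousAt.continuousWithinAt)
      (fun x hx => hd x (by linarith [hx.1]) (by linarith [hx.2]))
    rw [eq_div_iff (by linarith)] at hc
    have hle : 2 / (1 - c ^ 2) ≤ 2 / (1 - T ^ 2) :=
      div_le_div_of_nonneg_left (by norm_num) (hpos T hT hT1) (by nlinarith)
    have := mul_le_mul_of_nonneg_right hle (by linarith : 0 ≤ T - t)
    have e : 2 * (t - T) / (1 - T ^ 2) = -(2 / (1 - T ^ 2) * (T - t)) := by ring
    linarith
  · simp [h]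
  · obtain ⟨c, ⟨hc1, hc2⟩, hc⟩ := exists_hasDerivAt_eq_slope f (fun x => 2 / (1 - x ^ 2)) h
      (fun x hx => (hd x (by linarith [hx.1]) (by linarith [hx.2])).continuousAt.continuousWithinAt)
      (fun x hx => hd x (by linarith [hx.1]) (by linarith [hx.2]))
    rw [eq_div_iff (by linarith)] at hc
    have hle : 2 / (1 - T ^ 2) ≤ 2 / (1 - c ^ 2) :=
      div_le_div_of_nonneg_left (by norm_num) (hpos c (by linarith) (by linarith)) (by nlinarith)
    have := mul_le_mul_of_nonneg_right hle (by linarith : 0 ≤ t - T)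
    have e : 2 * (t - T) / (1 - T ^ 2) = 2 / (1 - T ^ 2) * (t - T) := by ring
    linarith

theorem mul_le_sq_add_one_sub_of_circle {C S T x y ρ : ℝ} (hCS : C ^ 2 + S ^ 2 = 1) (hS : 0 < S)
    (hT : 0 < T) (hT1 : T ≤ 1) (hρ : 0 < ρ) (hxy : x ^ 2 + y ^ 2 = ρ ^ 2)
    (hD : 0 < T * (ρ ^ 2 - 1) + 2 * S * y) :
    (1 - T * Real.log ρ / S ^ 2) * (T * (ρ ^ 2 - 1) + 2 * S * y) ≤ ρ ^ 2 + 1 - 2 * C * x := by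
  have hnum : 0 ≤ ρ ^ 2 + 1 - 2 * C * x := by
    nlinarith [sq_nonneg (x - C), sq_nonneg y, sq_nonneg S]
  set L := Real.log ρ with hL
  set δ := T * L / S ^ 2 with hδ
  have hSδ : S ^ 2 * δ = T * L := by rw [hδ]; field_simp
  rcases le_or_gt (1 - δ) 0 with hW | hW
  · exact (mul_nonpos_of_nonpos_of_nonneg hW hD.le).trans hnum
  have hS1 : S ^ 2 ≤ 1 := by nlinarith [sq_nonneg C]
  have hK : 0 ≤ 1 - S ^ 2 * δ + S ^ 2 * δ ^ 2 / 2 := by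
    nlinarith [sq_nonneg (1 - δ), mul_nonneg (sq_nonneg S) (sq_nonneg (1 - δ))]
  have hcs : C * x + (1 - δ) * S * y ≤ ρ * (1 - S ^ 2 * δ + S ^ 2 * δ ^ 2 / 2) := by
    refine abs_le_of_sq_le_sq' ?_ (by positivity) |>.2
    have h1 : (C * x + (1 - δ) * S * y) ^ 2 ≤ ρ ^ 2 * (C ^ 2 + ((1 - δ) * S) ^ 2) := by
      rw [← hxy]; nlinarith [sq_nonneg (C * y - (1 - δ) * S * x)]
    have h2 : C ^ 2 + ((1 - δ) * S) ^ 2 ≤ (1 - S ^ 2 * δ + S ^ 2 * δ ^ 2 / 2) ^ 2 := by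
      have : C ^ 2 = 1 - S ^ 2 := by linarith
      rw [this]; nlinarith [sq_nonneg (S ^ 2 * δ - S ^ 2 * δ ^ 2 / 2)]
    rw [mul_pow]
    exact h1.trans (mul_le_mul_of_nonneg_left h2 (sq_nonneg ρ))
  have hlog : ρ - 1 ≤ ρ * L := by
    have h := Real.one_sub_inv_le_log_of_pos hρ
    have := mul_le_mul_of_nonneg_left h hρ.le
    rwa [mul_sub, mul_one, mul_inv_cancel₀ hρ.ne'] at this
  have hLu : L ≤ ρ - 1 := Real.log_le_sub_one_of_pos hρ
  have hscalar : (1 - δ) * T * (ρ ^ 2 - 1) ≤ (ρ - 1) ^ 2 + 2 * ρ * (T * L) * (1 - δ / 2) := by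
    rcases le_or_gt 1 ρ with h | h
    · have hL0 : 0 ≤ L := Real.log_nonneg h
      have hδ0 : 0 ≤ δ := by positivity
      have a1 : T * (1 - δ) * (ρ - 1) ^ 2 ≤ (ρ - 1) ^ 2 := by
        have : T * (1 - δ) ≤ 1 := by nlinarith
        nlinarith [sq_nonneg (ρ - 1)]
      have a2 : 0 ≤ (T * (1 - δ)) * (ρ * L - (ρ - 1)) :=
        mul_nonneg (mul_nonneg hT.le hW.le) (by linarith)
      have a3 : 0 ≤ ρ * (T * L) * δ := by positivity
      nlinarith
    · have hL0 : L ≤ 0 := Real.log_nonpos hρ.le h.le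
      have hδ0 : δ ≤ 0 := by
        rw [hδ]; exact div_nonpos_of_nonpos_of_nonneg (mul_nonpos_of_nonneg_of_nonpos hT.le hL0)
          (sq_nonneg S)
      have a1 : 0 ≤ T * (1 - δ / 2) * (ρ * L - (ρ - 1)) :=
        mul_nonneg (mul_nonneg hT.le (by linarith)) (by linarith)
      have a2 : 0 ≤ (1 - T) * (1 - ρ) ^ 2 := mul_nonneg (by linarith) (sq_nonneg _)
      have a3 : 0 ≤ T * (-δ) * ρ * (1 - ρ) :=
        mul_nonneg (mul_nonneg (mul_nonneg hT.le (by linarith)) hρ.le) (by linarith)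
      nlinarith
  have e : ρ * (1 - S ^ 2 * δ + S ^ 2 * δ ^ 2 / 2) = ρ - ρ * (T * L) * (1 - δ / 2) := by
    have : S ^ 2 * δ ^ 2 = T * L * δ := by rw [← hSδ]; ring
    rw [this, hSδ]; ring
  rw [e] at hcs
  nlinarith

theorem log_ratio_add_le_log_sub {C S T X Y N M : ℝ} (hCS : C ^ 2 + S ^ 2 = 1) (hS : 0 < S)
    (hT : 0 < T) (hT1 : T < 1) (hN : 0 < N) (hM : 0 < M) (hXY : X ^ 2 + Y ^ 2 = N * M)
    (hV : 0 < C * X + S / T * Y - N) (hU : 0 < M - C * X + S / T * Y) :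
    Real.log (1 + T) - Real.log (1 - T)
        - T ^ 2 / ((1 - T ^ 2) * S ^ 2) * (Real.log M - Real.log N) ≤
      Real.log (M - C * X + S / T * Y) - Real.log (C * X + S / T * Y - N) := by
  set U := M - C * X + S / T * Y with hUd
  set V := C * X + S / T * Y - N with hVd
  have hS1 : S ^ 2 ≤ 1 := by nlinarith [sq_nonneg C]
  have hρ : 0 < √(M / N) := Real.sqrt_pos.2 (by positivity)
  have hρ2 : √(M / N) ^ 2 = M / N := Real.sq_sqrt (by positivity)
  have hDe : T * (√(M / N) ^ 2 - 1) + 2 * S * (Y / N) = T * (U + V) / N := by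
    rw [hρ2, hUd, hVd]; field_simp; ring
  have hDiff : √(M / N) ^ 2 + 1 - 2 * C * (X / N) = (U - V) / N := by
    rw [hρ2, hUd, hVd]; field_simp; ring
  have key := mul_le_sq_add_one_sub_of_circle (x := X / N) (y := Y / N) hCS hS hT hT1.le hρ
    (by rw [hρ2]; field_simp; linarith) (by rw [hDe]; positivity)
  rw [hDe, hDiff, Real.log_sqrt (by positivity), Real.log_div hM.ne' hN.ne'] at key
  set L := Real.log M - Real.log N with hL
  set t := (U - V) / (U + V) with ht
  have hUV : 0 < U + V := by linarith
  have key2 : (1 - T * (L / 2) / S ^ 2) * T ≤ t := by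
    rw [ht, le_div_iff₀ hUV]
    have h := mul_le_mul_of_nonneg_right key hN.le
    rw [div_mul_cancel₀ _ hN.ne'] at h
    have e : (1 - T * (L / 2) / S ^ 2) * (T * (U + V) / N) * N
      = (1 - T * (L / 2) / S ^ 2) * T * (U + V) := by field_simp
    linarith
  have ht0 : 0 ≤ t := by
    have h0 : 0 ≤ √(M / N) ^ 2 + 1 - 2 * C * (X / N) := by
      have hx : (X / N) ^ 2 ≤ √(M / N) ^ 2 := by
        rw [hρ2, div_pow, div_le_div_iff₀ (by positivity) hN]
        nlinarith [sq_nonneg Y, mul_nonneg hN.le (sq_nonneg Y)]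
      nlinarith [sq_nonneg (X / N - C), sq_nonneg S]
    rw [hDiff] at h0
    have : 0 ≤ U - V := by
      have := mul_nonneg h0 hN.le
      rwa [div_mul_cancel₀ _ hN.ne'] at this
    positivity
  have ht1 : t < 1 := by rw [ht, div_lt_one hUV]; linarith
  have hlog := two_mul_sub_div_le_log_sub ht0 ht1 hT.le hT1
  have e1 : 1 + t = 2 * U / (U + V) := by rw [ht]; field_simp; ring
  have e2 : 1 - t = 2 * V / (U + V) := by rw [ht]; field_simp; ring
  rw [e1, e2, Real.log_div (by positivity) hUV.ne', Real.log_div (by positivity) hUV.ne',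
    Real.log_mul two_ne_zero hU.ne', Real.log_mul two_ne_zero hV.ne'] at hlog
  have hT2 : 0 < 1 - T ^ 2 := by nlinarith
  have e3 : T ^ 2 / ((1 - T ^ 2) * S ^ 2) * L =
      2 * (T - (1 - T * (L / 2) / S ^ 2) * T) / (1 - T ^ 2) := by
    field_simp; ring
  have e4 : 2 * (T - t) / (1 - T ^ 2) ≤ T ^ 2 / ((1 - T ^ 2) * S ^ 2) * L := by
    rw [e3]; gcongr
  have e5 : 2 * (T - t) / (1 - T ^ 2) = - (2 * (t - T) / (1 - T ^ 2)) := by ring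
  linarith

theorem log_one_add_tanh_sub (x : ℝ) :
    Real.log (1 + Real.tanh x) - Real.log (1 - Real.tanh x) = 2 * x := by
  have hc := Real.cosh_pos x
  have e1 : 1 + Real.tanh x = Real.exp x / Real.cosh x := by
    rw [Real.tanh_eq_sinh_div_cosh, ← Real.cosh_add_sinh]; field_simp
  have e2 : 1 - Real.tanh x = Real.exp (-x) / Real.cosh x := by
    rw [Real.tanh_eq_sinh_div_cosh, ← Real.cosh_sub_sinh]; field_simp
  rw [e1, e2, Real.log_div (Real.exp_pos _).ne' hc.ne', Real.log_div (Real.exp_pos _).ne' hc.ne',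
    Real.log_exp, Real.log_exp]
  ring

section Cycle

variable {n : ℕ} [NeZero n]

theorem ZMod.forall_of_sub_one {P : ZMod n → Prop} (h : ∀ i, P (i - 1) → P i) {i : ZMod n}
    (hi : P i) (j : ZMod n) : P j := by
  have key : ∀ k : ℕ, P (i + k) := by
    intro k
    induction k with
    | zero => simpa using hi
    | succ k ih => refine h _ ?_; push_cast; rwa [← add_assoc, add_sub_cancel_right]
  have := key (j - i).val
  rwa [ZMod.natCast_zmod_val, add_sub_cancel] at this

theorem ZMod.forall_of_add_one {P : ZMod n → Prop} (h : ∀ i, P i → P (i - 1)) {i : ZMod n}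
    (hi : P i) (j : ZMod n) : P j := by
  by_contra hj
  exact ZMod.forall_of_sub_one (P := fun k => ¬ P k) (fun k hk hk' => hk (h k hk')) hj i hi

theorem ZMod.sum_sub_one (f : ZMod n → ℝ) : ∑ i, f (i - 1) = ∑ i, f i :=
  Equiv.sum_comp (Equiv.subRight (1 : ZMod n)) f

theorem ZMod.sum_add_one (f : ZMod n → ℝ) : ∑ i, f (i + 1) = ∑ i, f i :=
  Equiv.sum_comp (Equiv.addRight (1 : ZMod n)) f

theorem sum_log_sub_lt_affinity {kp km A B : ZMod n → ℝ} (hkp : ∀ i, 0 < kp i)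
    (hkm : ∀ i, 0 < km i) (hA : ∀ i, 0 < A i) (hB : ∀ i, 0 < B i)
    (h : ∀ i, km i * B (i - 1) < kp i * A i) :
    ∑ i, (Real.log (B i) - Real.log (A i)) < ∑ i, Real.log (kp i / km i) := by
  rw [sum_sub_distrib, ← ZMod.sum_sub_one (fun i => Real.log (B i)), ← sum_sub_distrib]
  refine sum_lt_sum_of_nonempty univ_nonempty fun i _ => ?_
  have := Real.log_lt_log (mul_pos (hkm i) (hB _)) (h i)
  rw [Real.log_mul (hkm i).ne' (hB _).ne', Real.log_mul (hkp i).ne' (hA _).ne'] at this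
  rw [Real.log_div (hkp i).ne' (hkm i).ne']
  linarith

theorem affinity_lt_sum_log_sub {kp km A B : ZMod n → ℝ} (hkp : ∀ i, 0 < kp i)
    (hkm : ∀ i, 0 < km i) (hA : ∀ i, 0 < A i) (hB : ∀ i, 0 < B i)
    (h : ∀ i, kp i * A i < km i * B (i - 1)) :
    ∑ i, Real.log (kp i / km i) < ∑ i, (Real.log (B i) - Real.log (A i)) := by
  rw [sum_sub_distrib, ← ZMod.sum_sub_one (fun i => Real.log (B i)), ← sum_sub_distrib]
  refine sum_lt_sum_of_nonempty univ_nonempty fun i _ => ?_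
  have := Real.log_lt_log (mul_pos (hkp i) (hA _)) (h i)
  rw [Real.log_mul (hkm i).ne' (hB _).ne', Real.log_mul (hkp i).ne' (hA _).ne'] at this
  rw [Real.log_div (hkp i).ne' (hkm i).ne']
  linarith

end Cycle

section Bound

variable {n : ℕ} [NeZero n]

theorem uniT_of_exists_eq_zero {kp km : ZMod n → ℝ} (h : ∃ i, km i = 0) : uniT n kp km = 1 := by
  rw [uniT, if_neg (by push Not; exact h)]

theorem uniT_of_pos {kp km : ZMod n → ℝ} (h : ∀ i, 0 < km i) :
    uniT n kp km = Real.tanh ((∑ i : ZMod n, Real.log (kp i / km i)) / (2 * n)) := by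
  rw [uniT, if_pos fun i => (h i).ne']

/-- A cycle of complex numbers `u i` is encoded by `N i = |u i|²`, and by the real part `X i` and
the imaginary part `Y i` of `conj (u i) * u (i + 1)`. -/
theorem pos_of_flux_eq {kp km N X Y : ZMod n → ℝ} (hkp : ∀ i, 0 < kp i) (hkm : ∀ i, 0 ≤ km i)
    (hF : (∀ i, km i ≠ 0) → 0 ≤ ∑ i : ZMod n, Real.log (kp i / km i))
    (hN : ∀ i, 0 ≤ N i) (hN0 : ∃ i, N i ≠ 0) {ν : ℝ} (hν : 0 < ν)
    (hXY : ∀ i, X i ^ 2 + Y i ^ 2 = N i * N (i + 1))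
    (hflux : ∀ i, kp i * Y i - km i * Y (i - 1) = ν * N i) : (∀ i, 0 < Y i) ∧ ∀ i, 0 < N i := by
  have hNpos : ∀ i, Y i ≠ 0 → 0 < N i ∧ 0 < N (i + 1) := by
    intro i hi
    have h : 0 < N i * N (i + 1) := by rw [← hXY]; positivity
    exact ⟨(hN i).lt_of_ne' (left_ne_zero_of_mul h.ne'),
      (hN (i + 1)).lt_of_ne' (right_ne_zero_of_mul h.ne')⟩
  suffices hY : ∃ i, 0 < Y i by
    obtain ⟨i, hi⟩ := hY
    have hall : ∀ j, 0 < Y j := by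
      refine ZMod.forall_of_sub_one (fun j hj => ?_) hi
      have h1 := (hNpos (j - 1) hj.ne').2
      rw [sub_add_cancel] at h1
      have h2 : 0 < kp j * Y j := by
        linarith [hflux j, mul_nonneg (hkm j) hj.le, mul_pos hν h1]
      exact (mul_pos_iff_of_pos_left (hkp j)).1 h2
    exact ⟨hall, fun j => (hNpos j (hall j).ne').1⟩
  by_contra! hY
  have hne : ∀ i, Y i ≠ 0 := by
    intro i hi
    have h0 : ∀ j, Y j = 0 := by
      refine ZMod.forall_of_sub_one (fun j hj => ?_) hi
      have h := hflux j
      rw [hj, mul_zero, sub_zero] at h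
      have h2 : 0 ≤ kp j * Y j := by rw [h]; exact mul_nonneg hν.le (hN j)
      exact le_antisymm (hY j) (nonneg_of_mul_nonneg_right h2 (hkp j))
    obtain ⟨j, hj⟩ := hN0
    have h := hflux j
    rw [h0, h0, mul_zero, mul_zero, sub_zero] at h
    exact (mul_ne_zero hν.ne' hj) h.symm
  have hZ : ∀ i, 0 < -Y i := fun i => by
    have := (hY i).lt_of_ne (hne i); linarith
  have hlt : ∀ i, kp i * -Y i < km i * -Y (i - 1) := fun i => by
    linarith [hflux i, mul_pos hν (hNpos i (hne i)).1]
  have hkm' : ∀ i, 0 < km i := fun i =>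
    pos_of_mul_pos_left ((mul_pos (hkp i) (hZ i)).trans (hlt i)) (hZ _).le
  have := affinity_lt_sum_log_sub hkp hkm' hZ hZ hlt
  simp only [sub_self, sum_const_zero] at this
  exact absurd (hF fun i => (hkm' i).ne') this.not_ge

theorem uniT_pos {kp km Y : ZMod n → ℝ} (hkp : ∀ i, 0 < kp i) (hkm : ∀ i, 0 ≤ km i)
    (hY : ∀ i, 0 < Y i) (hflux : ∀ i, km i * Y (i - 1) < kp i * Y i) :
    0 < uniT n kp km := by
  by_cases h : ∀ i, km i ≠ 0
  · have hkm' : ∀ i, 0 < km i := fun i => (hkm i).lt_of_ne' (h i)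
    have hF := sum_log_sub_lt_affinity hkp hkm' hY hY hflux
    simp only [sub_self, sum_const_zero] at hF
    have hn : (0 : ℝ) < n := by exact_mod_cast Nat.pos_of_ne_zero (NeZero.ne n)
    rw [uniT_of_pos hkm']
    rw [Real.tanh_eq_sinh_div_cosh]
    exact div_pos (Real.sinh_pos_iff.2 (by positivity)) (Real.cosh_pos _)
  · push Not at h
    rw [uniT_of_exists_eq_zero h]
    norm_num

/-- The functional `C X + (S / T) Y - N`, which defines a tangent line of the ellipse, cannot push
all the local balance equations outside of the ellipse. -/
theorem not_forall_tangent_lt {kp km N X Y : ZMod n → ℝ} {C S T : ℝ} (hkp : ∀ i, 0 < kp i)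
    (hkm : ∀ i, 0 ≤ km i) (hF : (∀ i, km i ≠ 0) → 0 ≤ ∑ i : ZMod n, Real.log (kp i / km i))
    (hN : ∀ i, 0 < N i) (hXY : ∀ i, X i ^ 2 + Y i ^ 2 = N i * N (i + 1))
    (hCS : C ^ 2 + S ^ 2 = 1) (hS : 0 < S) (hT : T = uniT n kp km) (hT0 : 0 < T) :
    ¬ ∀ i, km i * (N i - C * X (i - 1) + S / T * Y (i - 1)) <
      kp i * (C * X i + S / T * Y i - N i) := by
  intro h
  set V : ZMod n → ℝ := fun i => C * X i + S / T * Y i - N i with hV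
  set U : ZMod n → ℝ := fun i => N (i + 1) - C * X i + S / T * Y i with hU
  have hstep : ∀ i, km i * U (i - 1) < kp i * V i := by
    intro i; simpa [hU, hV] using h i
  have hVU : ∀ i, V i < U i := by
    intro i
    have h1 : (2 * (C * X i)) ^ 2 < (N i + N (i + 1)) ^ 2 := by
      have hC : C ^ 2 < 1 := by nlinarith
      have hP := mul_pos (hN i) (hN (i + 1))
      have hX : X i ^ 2 ≤ N i * N (i + 1) := by nlinarith [hXY i, sq_nonneg (Y i)]
      have h2 : C ^ 2 * X i ^ 2 < N i * N (i + 1) := by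
        nlinarith [mul_le_mul_of_nonneg_left hX (sq_nonneg C)]
      nlinarith [sq_nonneg (N i - N (i + 1))]
    have h2 := abs_lt_of_sq_lt_sq h1 (add_pos (hN i) (hN (i + 1))).le
    simp only [hU, hV]
    linarith [(abs_lt.1 h2).2]
  have hVpos : ∀ i, 0 < V i := by
    by_contra! hneg
    obtain ⟨i, hi⟩ := hneg
    have hprop : ∀ j, V j ≤ 0 → km j ≠ 0 ∧ U (j - 1) < 0 := by
      intro j hj
      have h1 : km j * U (j - 1) < 0 :=
        (hstep j).trans_le (mul_nonpos_of_nonneg_of_nonpos (hkp j).le hj)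
      refine ⟨fun h0 => by simp [h0] at h1, ?_⟩
      exact neg_of_mul_neg_right h1 (hkm j)
    have hall : ∀ j, V j ≤ 0 :=
      ZMod.forall_of_add_one (fun j hj => ((hVU (j - 1)).trans (hprop j hj).2).le) hi
    have hkm' : ∀ j, 0 < km j := fun j => (hkm j).lt_of_ne' (hprop j (hall j)).1
    have hUneg : ∀ j, U j < 0 := fun j => by
      have := (hprop (j + 1) (hall _)).2
      rwa [add_sub_cancel_right] at this
    have h1 := affinity_lt_sum_log_sub (A := fun i => -V i) (B := fun i => -U i) hkp hkm'
      (fun j => by linarith [hVU j, hUneg j]) (fun j => by linarith [hUneg j])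
      (fun j => by linarith [hstep j])
    have h2 : ∑ i, (Real.log (-U i) - Real.log (-V i)) ≤ 0 :=
      sum_nonpos fun j _ => sub_nonpos.2 <|
        Real.log_le_log (by linarith [hUneg j]) (by linarith [hVU j])
    linarith [hF fun j => (hkm' j).ne']
  by_cases hk : ∀ i, km i ≠ 0
  · have hkm' : ∀ i, 0 < km i := fun i => (hkm i).lt_of_ne' (hk i)
    have hUpos : ∀ i, 0 < U i := fun i => (hVpos i).trans (hVU i)
    have h1 := sum_log_sub_lt_affinity hkp hkm' hVpos hUpos hstep
    have hTe := hT.trans (uniT_of_pos hkm')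
    have hT1' : T < 1 := by rw [hTe]; exact Real.tanh_lt_one _
    have h2 := sum_le_sum fun i (_ : i ∈ univ) =>
      log_ratio_add_le_log_sub hCS hS hT0 hT1' (hN i) (hN (i + 1)) (hXY i) (hVpos i) (hUpos i)
    have hshift : ∑ i, (Real.log (N (i + 1)) - Real.log (N i)) = 0 := by
      rw [sum_sub_distrib, ZMod.sum_add_one (fun i => Real.log (N i)), sub_self]
    have hconst : Real.log (1 + T) - Real.log (1 - T) =
        2 * ((∑ i : ZMod n, Real.log (kp i / km i)) / (2 * n)) := by
      rw [hTe, log_one_add_tanh_sub]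
    simp only [hconst] at h2
    rw [sum_sub_distrib, ← mul_sum, ← mul_sum, hshift, mul_zero, sub_zero, sum_const, card_univ,
      ZMod.card, nsmul_eq_mul] at h2
    have hn : (n : ℝ) ≠ 0 := NeZero.ne _
    have h3 : (n : ℝ) * (2 * ((∑ i : ZMod n, Real.log (kp i / km i)) / (2 * n))) =
        ∑ i : ZMod n, Real.log (kp i / km i) := by field_simp
    linarith
  · push Not at hk
    have hT' : T = 1 := hT.trans (uniT_of_exists_eq_zero hk)
    have hlt : ∀ i, N i < N (i + 1) := by
      intro i
      have h1 : N i < C * X i + S * Y i := by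
        have := hVpos i
        simp only [hV, hT', div_one] at this
        linarith
      have h2 : (C * X i + S * Y i) ^ 2 ≤ N i * N (i + 1) := by
        have : (C * X i + S * Y i) ^ 2 ≤ (C ^ 2 + S ^ 2) * (X i ^ 2 + Y i ^ 2) := by
          nlinarith [sq_nonneg (C * Y i - S * X i)]
        rwa [hCS, hXY, one_mul] at this
      have h3 : N i * N i < N i * N (i + 1) := by nlinarith [hN i]
      exact lt_of_mul_lt_mul_left h3 (hN i).le
    have := sum_lt_sum_of_nonempty (univ_nonempty (α := ZMod n)) fun i _ => hlt i
    rw [ZMod.sum_add_one] at this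
    exact lt_irrefl _ this

theorem exists_left_eigenvector (hn : 3 ≤ n) {kp km : ZMod n → ℝ} {lam : ℂ}
    (heig : ∃ v : ZMod n → ℂ, v ≠ 0 ∧ uniGenC n kp km *ᵥ v = lam • v) :
    ∃ u : ZMod n → ℂ, u ≠ 0 ∧
      ∀ i, kp i * u (i + 1) + km i * u (i - 1) = (lam + (kp i + km i)) * u i := by
  obtain ⟨v, hv0, hv⟩ := heig
  have hdet : (uniGenC n kp km - lam • (1 : Matrix (ZMod n) (ZMod n) ℂ)).det = 0 := by
    refine exists_mulVec_eq_zero_iff.1 ⟨v, hv0, ?_⟩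
    rw [sub_mulVec, hv, smul_mulVec, one_mulVec, sub_self]
  obtain ⟨u, hu0, hu⟩ := exists_vecMul_eq_zero_iff.2 hdet
  refine ⟨u, hu0, fun i => ?_⟩
  rw [vecMul_sub, vecMul_smul, vecMul_one, sub_eq_zero] at hu
  have hi := congrFun hu i
  have : Fact (2 < n) := ⟨hn⟩
  have : Fact (1 < n) := ⟨by lia⟩
  have h1 : i + 1 ≠ i - 1 := by
    intro h
    refine ZMod.neg_one_ne_one (n := n) ?_
    rw [sub_eq_add_neg] at h
    exact (add_left_cancel h).symm
  have h2 : i ≠ i + 1 := by simp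
  have h3 : i ≠ i - 1 := fun h => one_ne_zero (sub_eq_self.1 h.symm)
  have hterm : ∀ j, u j * uniGenC n kp km j i =
      (if j = i + 1 then u j * kp i else 0) + (if j = i - 1 then u j * km i else 0)
        + (if j = i then u j * -(kp i + km i) else 0) := by
    intro j
    simp only [uniGenC, of_apply]
    by_cases e1 : j = i + 1
    · subst e1; simp [h1]
    · by_cases e2 : j = i - 1
      · subst e2; simp [h1.symm]
      · by_cases e3 : j = i
        · subst e3; simp [e1, e2]
        · simp [e1, e2, e3]
  simp only [vecMul, dotProduct, hterm, sum_add_distrib, sum_ite_eq', mem_univ, if_true,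
    Pi.smul_apply, smul_eq_mul] at hi
  linear_combination hi

theorem exists_norm_add_le {kp km : ZMod n → ℝ} (hkp : ∀ i, 0 < kp i) (hkm : ∀ i, 0 ≤ km i)
    {lam : ℂ} {u : ZMod n → ℂ} (hu0 : u ≠ 0)
    (hu : ∀ i, kp i * u (i + 1) + km i * u (i - 1) = (lam + (kp i + km i)) * u i) :
    ∃ i, ‖lam + (kp i + km i)‖ ≤ kp i + km i := by
  obtain ⟨i, hi⟩ := Finite.exists_max fun i => ‖u i‖
  refine ⟨i, ?_⟩
  have hpos : 0 < ‖u i‖ := by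
    obtain ⟨j, hj⟩ := Function.ne_iff.1 hu0
    exact (norm_pos_iff.2 hj).trans_le (hi j)
  refine le_of_mul_le_mul_right ?_ hpos
  rw [← norm_mul, ← hu]
  refine (norm_add_le _ _).trans ?_
  rw [norm_mul, norm_mul, Complex.norm_of_nonneg (hkp i).le, Complex.norm_of_nonneg (hkm i),
    add_mul]
  exact add_le_add (mul_le_mul_of_nonneg_left (hi _) (hkp i).le)
    (mul_le_mul_of_nonneg_left (hi _) (hkm i))

theorem im_le_of_left_eigenvector {kp km : ZMod n → ℝ} (hkp : ∀ i, 0 < kp i)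
    (hkm : ∀ i, 0 ≤ km i) (hF : (∀ i, km i ≠ 0) → 0 ≤ ∑ i : ZMod n, Real.log (kp i / km i))
    {r : ℝ} (hr : ∀ i, kp i + km i ≤ r) {lam : ℂ} (him : 0 < lam.im)
    (hre : -(2 * r) < lam.re) (hre' : lam.re < 0) {u : ZMod n → ℂ} (hu0 : u ≠ 0)
    (hu : ∀ i, kp i * u (i + 1) + km i * u (i - 1) = (lam + (kp i + km i)) * u i) :
    lam.im ≤ uniT n kp km * √((-lam.re) * (2 * r + lam.re)) := by
  set N : ZMod n → ℝ := fun i => Complex.normSq (u i) with hN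
  set X : ZMod n → ℝ := fun i => (u i).re * (u (i + 1)).re + (u i).im * (u (i + 1)).im with hX
  set Y : ZMod n → ℝ := fun i => (u i).re * (u (i + 1)).im - (u i).im * (u (i + 1)).re with hY
  have hXY : ∀ i, X i ^ 2 + Y i ^ 2 = N i * N (i + 1) := by
    intro i; simp only [hN, hX, hY, Complex.normSq_apply]; ring
  have hur : ∀ i, kp i * (u (i + 1)).re + km i * (u (i - 1)).re =
      (lam.re + (kp i + km i)) * (u i).re - lam.im * (u i).im := by
    intro i; simpa using congrArg Complex.re (hu i)
  have hui : ∀ i, kp i * (u (i + 1)).im + km i * (u (i - 1)).im =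
      (lam.re + (kp i + km i)) * (u i).im + lam.im * (u i).re := by
    intro i; simpa using congrArg Complex.im (hu i)
  have hreal : ∀ i, kp i * X i + km i * X (i - 1) = (lam.re + (kp i + km i)) * N i := by
    intro i
    simp only [hN, hX, Complex.normSq_apply, sub_add_cancel]
    linear_combination (u i).re * hur i + (u i).im * hui i
  have hflux : ∀ i, kp i * Y i - km i * Y (i - 1) = lam.im * N i := by
    intro i
    simp only [hN, hY, Complex.normSq_apply, sub_add_cancel]
    linear_combination (u i).re * hui i - (u i).im * hur i
  obtain ⟨hYpos, hNpos⟩ := pos_of_flux_eq hkp hkm hF (fun i => Complex.normSq_nonneg _)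
    (by obtain ⟨j, hj⟩ := Function.ne_iff.1 hu0
        exact ⟨j, (Complex.normSq_pos.2 hj).ne'⟩) him hXY hflux
  have hT0 : 0 < uniT n kp km := uniT_pos hkp hkm hYpos fun i => by
    linarith [hflux i, mul_pos him (hNpos i)]
  have hr0 : 0 < r := by linarith
  have hE : 0 < (-lam.re) * (2 * r + lam.re) := mul_pos (by linarith) (by linarith)
  set Q := √((-lam.re) * (2 * r + lam.re)) with hQ
  have hQ0 : 0 < Q := Real.sqrt_pos.2 hE
  have hQ2 : Q ^ 2 = (-lam.re) * (2 * r + lam.re) := Real.sq_sqrt hE.le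
  by_contra! hcon
  refine not_forall_tangent_lt (C := (r + lam.re) / r) (S := Q / r) hkp hkm hF hNpos hXY ?_
    (by positivity) rfl hT0 fun i => ?_
  · rw [div_pow, div_pow, hQ2]; field_simp; ring
  set T := uniT n kp km
  have hQT : Q ^ 2 < Q / T * lam.im := by
    rw [div_mul_eq_mul_div, lt_div_iff₀ hT0]
    nlinarith
  have hid : r * (kp i * ((r + lam.re) / r * X i + Q / r / T * Y i - N i) -
      km i * (N i - (r + lam.re) / r * X (i - 1) + Q / r / T * Y (i - 1))) =
      ((r + lam.re) * (lam.re + (kp i + km i)) + Q / T * lam.im - r * (kp i + km i)) * N i := by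
    field_simp
    linear_combination (r + lam.re) * T * hreal i + Q * hflux i
  have hpos : 0 < ((r + lam.re) * (lam.re + (kp i + km i)) + Q / T * lam.im
      - r * (kp i + km i)) * N i := by
    refine mul_pos ?_ (hNpos i)
    nlinarith [mul_nonneg (neg_nonneg.2 hre'.le) (sub_nonneg.2 (hr i))]
  rw [← hid] at hpos
  exact sub_pos.1 ((mul_pos_iff_of_pos_left hr0).1 hpos)

end Bound

theorem unicyclic_ellipse_bound
    (n : ℕ) [NeZero n] (hn : 3 ≤ n)
    (kp km : ZMod n → ℝ) (hkp : ∀ i, 0 < kp i) (hkm : ∀ i, 0 ≤ km i)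
    (hF : (∀ i, km i ≠ 0) → 0 ≤ ∑ i : ZMod n, Real.log (kp i / km i))
    (r : ℝ) (hr : IsGreatest (Set.range fun i : ZMod n => kp i + km i) r)
    (lam : ℂ) (hlam : lam.im ≠ 0)
    (heig : ∃ v : ZMod n → ℂ, v ≠ 0 ∧ uniGenC n kp km *ᵥ v = lam • v) :
    (-(2 * r) < lam.re ∧ lam.re < 0) ∧
    |lam.im| ≤ uniT n kp km * Real.sqrt ((-lam.re) * (2 * r + lam.re)) := by
  have hr' : ∀ i, kp i + km i ≤ r := fun i => hr.2 ⟨i, rfl⟩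
  obtain ⟨u, hu0, hu⟩ := exists_left_eigenvector hn heig
  have hre : -(2 * r) < lam.re ∧ lam.re < 0 := by
    obtain ⟨i, hi⟩ := exists_norm_add_le hkp hkm hu0 hu
    have h1 := pow_le_pow_left₀ (norm_nonneg _) hi 2
    rw [← Complex.normSq_eq_norm_sq, Complex.normSq_apply] at h1
    simp only [Complex.add_re, Complex.add_im, Complex.ofReal_re, Complex.ofReal_im, add_zero]
      at h1
    have h2 : (lam.re + (kp i + km i)) ^ 2 < (kp i + km i) ^ 2 := by
      have : 0 < lam.im ^ 2 := by positivity
      nlinarith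
    have h3 := abs_lt.1 (abs_lt_of_sq_lt_sq h2 (add_nonneg (hkp i).le (hkm i)))
    exact ⟨by linarith [hr' i, h3.1], by linarith [h3.2]⟩
  refine ⟨hre, ?_⟩
  rcases hlam.lt_or_gt with h | h
  · rw [abs_of_neg h]
    refine im_le_of_left_eigenvector (lam := (starRingEnd ℂ) lam)
      (u := fun i => (starRingEnd ℂ) (u i)) hkp hkm hF hr' (by simpa using h) (by simpa using hre.1)
      (by simpa using hre.2) ?_ fun i => ?_
    · obtain ⟨j, hj⟩ := Function.ne_iff.1 hu0
      exact Function.ne_iff.2 ⟨j, by simpa using hj⟩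
    · simpa using congrArg (starRingEnd ℂ) (hu i)
  · rw [abs_of_pos h]
    exact im_le_of_left_eigenvector hkp hkm hF hr' h hre.1 hre.2 hu0 hu
end
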